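/- There exists a constant C₇ > 0 such that for every non-constant f ∈ RBMO(μ) (i.e. ‖f‖_{RBMO(μ)} > 0), setting k = C₇ ‖f‖_{RBMO(μ)}, one has ∫_{ℝ^d} ( exp( |f(x) − f_{𝕢̃}| / k ) − 1 ) · (1 + |x|)^{−(2n+κ)} dμ(x) ≤ 1, where 𝕢 denotes the unit cube centered at the origin and 𝕢̃ its smallest (ρ,β_ρ)-doubling dyadic dilate. -/

import Mathlib

open MeasureTheory Metric Set Filter
open scoped ENNReal NNReal BigOperators Topology

noncomputable section

/-- Euclidean space `ℝ^d`. -/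
abbrev Euc (d : ℕ) := EuclideanSpace ℝ (Fin d)

/-- A (closed, axis-parallel) cube in `ℝ^d`, given by its center and side length. -/
structure Cube (d : ℕ) where
  center : Euc d
  side : ℝ

namespace Cube

/-- The underlying set of a cube. -/
def set {d : ℕ} (Q : Cube d) : Set (Euc d) :=
  {y : Euc d | ∀ i, |y i - Q.center i| ≤ Q.side / 2}

/-- The concentric dilate `αQ` of a cube. -/
def dilate {d : ℕ} (Q : Cube d) (α : ℝ) : Cube d := ⟨Q.center, α * Q.side⟩

end Cube

/-- `Q` is a genuine cube for `μ`: positive side length, centered at a point of `supp μ`. -/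
def IsCube {d : ℕ} (μ : Measure (Euc d)) (Q : Cube d) : Prop :=
  0 < Q.side ∧ ∀ r : ℝ, 0 < r → 0 < μ (Metric.ball Q.center r)

/-- The mean value `f_Q = μ(Q)⁻¹ ∫_Q f dμ`. -/
def cubeAvg {d : ℕ} (μ : Measure (Euc d)) (Q : Cube d) (f : Euc d → ℝ) : ℝ :=
  (μ Q.set).toReal⁻¹ * ∫ x in Q.set, f x ∂μ

/-- `N_{Q,R}`: the smallest positive integer `k` with `2^k ℓ(Q) ≥ ℓ(R)`. -/
def NQR {d : ℕ} (Q R : Cube d) : ℕ :=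
  sInf {k : ℕ | 0 < k ∧ R.side ≤ 2 ^ k * Q.side}

/-- The Tolsa coefficient `S_{Q,R} = 1 + ∑_{k=1}^{N_{Q,R}} μ(2^k Q)/ℓ(2^k Q)^n`. -/
def SQR {d : ℕ} (μ : Measure (Euc d)) (n : ℕ) (Q R : Cube d) : ℝ :=
  1 + ∑ k ∈ Finset.Icc 1 (NQR Q R),
      (μ (Q.dilate (2 ^ k)).set).toReal / (2 ^ k * Q.side) ^ n

/-- `Q` is `(α,β)`-doubling: `μ(αQ) ≤ β μ(Q)`. -/
def IsDoubling {d : ℕ} (μ : Measure (Euc d)) (α β : ℝ) (Q : Cube d) : Prop :=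
  μ (Q.dilate α).set ≤ ENNReal.ofReal β * μ Q.set

/-- `Q̃ = 2^N Q`, `N` the smallest non-negative integer making `2^N Q` `(ρ,β)`-doubling. -/
def tilde {d : ℕ} (μ : Measure (Euc d)) (ρ β : ℝ) (Q : Cube d) : Cube d :=
  Q.dilate (2 ^ sInf {N : ℕ | IsDoubling μ ρ β (Q.dilate (2 ^ N))})

/-- `C` is an `RBMO(μ)` bound for `f` (with parameters `η, ρ, β`). -/
def RBMOBound {d : ℕ} (μ : Measure (Euc d)) (n : ℕ) (η ρ β : ℝ)
    (f : Euc d → ℝ) (C : ℝ) : Prop :=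
  (∀ Q : Cube d, IsCube μ Q →
      ∫ x in Q.set, |f x - cubeAvg μ (tilde μ ρ β Q) f| ∂μ
        ≤ C * (μ (Q.dilate η).set).toReal) ∧
  (∀ Q R : Cube d, IsCube μ Q → IsCube μ R → Q.set ⊆ R.set →
      IsDoubling μ ρ β Q → IsDoubling μ ρ β R →
      |cubeAvg μ Q f - cubeAvg μ R f| ≤ C * SQR μ n Q R)

/-- `f ∈ RBMO(μ)`. -/
def MemRBMO {d : ℕ} (μ : Measure (Euc d)) (n : ℕ) (η ρ β : ℝ) (f : Euc d → ℝ) : Prop :=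
  LocallyIntegrable f μ ∧ ∃ C : ℝ, 0 ≤ C ∧ RBMOBound μ n η ρ β f C

/-- The `RBMO(μ)` norm of `f`. -/
def rbmoNorm {d : ℕ} (μ : Measure (Euc d)) (n : ℕ) (η ρ β : ℝ) (f : Euc d → ℝ) : ℝ :=
  sInf {C : ℝ | 0 ≤ C ∧ RBMOBound μ n η ρ β f C}

/-- `C` is an `rbmo(μ)` (local `RBMO`) bound for `f`. -/
def RbmoLocBound {d : ℕ} (μ : Measure (Euc d)) (n : ℕ) (η ρ β : ℝ)
    (f : Euc d → ℝ) (C : ℝ) : Prop :=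
  (∀ Q : Cube d, IsCube μ Q → Q.side ≤ 1 →
      ∫ x in Q.set, |f x - cubeAvg μ (tilde μ ρ β Q) f| ∂μ
        ≤ C * (μ (Q.dilate η).set).toReal) ∧
  (∀ Q R : Cube d, IsCube μ Q → IsCube μ R → Q.side ≤ 1 → Q.set ⊆ R.set →
      IsDoubling μ ρ β Q → IsDoubling μ ρ β R →
      |cubeAvg μ Q f - cubeAvg μ R f| ≤ C * SQR μ n Q R) ∧
  (∀ Q : Cube d, IsCube μ Q → 1 < Q.side →
      ∫ x in Q.set, |f x| ∂μ ≤ C * (μ (Q.dilate η).set).toReal)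

/-- `f ∈ rbmo(μ)`. -/
def MemRbmoLoc {d : ℕ} (μ : Measure (Euc d)) (n : ℕ) (η ρ β : ℝ) (f : Euc d → ℝ) : Prop :=
  LocallyIntegrable f μ ∧ ∃ C : ℝ, 0 ≤ C ∧ RbmoLocBound μ n η ρ β f C

/-- The `rbmo(μ)` norm of `f`. -/
def rbmoLocNorm {d : ℕ} (μ : Measure (Euc d)) (n : ℕ) (η ρ β : ℝ) (f : Euc d → ℝ) : ℝ :=
  sInf {C : ℝ | 0 ≤ C ∧ RbmoLocBound μ n η ρ β f C}

/-- The data of an `∞`-block: `b = ∑ λ_j a_j`, supported in `R`, with `a_j` supported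
in `Q_j ⊂ R` and `‖a_j‖_{L^∞(μ)} ≤ (μ(2Q_j) S_{Q_j,R})⁻¹`, `∑_j |λ_j| < ∞`. -/
structure PreBlock {d : ℕ} (μ : Measure (Euc d)) (n : ℕ) : Type where
  R : Cube d
  Qs : ℕ → Cube d
  lam : ℕ → ℝ
  a : ℕ → Euc d → ℝ
  isCubeR : IsCube μ R
  isCubeQs : ∀ j, IsCube μ (Qs j)
  subsetQR : ∀ j, (Qs j).set ⊆ R.set
  measA : ∀ j, Measurable (a j)
  suppA : ∀ j, Function.support (a j) ⊆ (Qs j).set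
  boundA : ∀ j x, |a j x| ≤ ((μ ((Qs j).dilate 2).set).toReal * SQR μ n (Qs j) R)⁻¹
  summable : Summable fun j => |lam j|

/-- The function determined by a block. -/
def PreBlock.fn {d : ℕ} {μ : Measure (Euc d)} {n : ℕ} (b : PreBlock μ n) : Euc d → ℝ :=
  fun x => ∑' j, b.lam j * b.a j x

/-- `|b| = ∑_j |λ_j|`. -/
def PreBlock.size {d : ℕ} {μ : Measure (Euc d)} {n : ℕ} (b : PreBlock μ n) : ℝ :=
  ∑' j, |b.lam j|

/-- An `∞`-atomic block: an `∞`-block with vanishing integral. -/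
structure AtomicBlock {d : ℕ} (μ : Measure (Euc d)) (n : ℕ) extends PreBlock μ n where
  cancel : ∫ x, (∑' j, lam j * a j x) ∂μ = 0

/-- The function determined by an atomic block. -/
def AtomicBlock.fn {d : ℕ} {μ : Measure (Euc d)} {n : ℕ} (b : AtomicBlock μ n) : Euc d → ℝ :=
  b.toPreBlock.fn

/-- `|b|_{H¹} = ∑_j |λ_j|`. -/
def AtomicBlock.size {d : ℕ} {μ : Measure (Euc d)} {n : ℕ} (b : AtomicBlock μ n) : ℝ :=
  b.toPreBlock.size

/-- The class of test functions `F(x)` of Tolsa's grand maximal function. -/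
def TestFun {d : ℕ} (μ : Measure (Euc d)) (n : ℕ) (x : Euc d) (φ : Euc d → ℝ) : Prop :=
  Integrable φ μ ∧ ContDiff ℝ 1 φ ∧ (∫ y, |φ y| ∂μ) ≤ 1 ∧
  (∀ y, 0 ≤ φ y) ∧ (∀ y, y ≠ x → φ y ≤ (‖y - x‖ ^ n)⁻¹) ∧
  (∀ y, y ≠ x → ‖fderiv ℝ φ y‖ ≤ (‖y - x‖ ^ (n + 1))⁻¹)

/-- The grand maximal function `M f(x) = sup_{φ ∈ F(x)} |∫ f φ dμ|`. -/
def grandM {d : ℕ} (μ : Measure (Euc d)) (n : ℕ) (f : Euc d → ℝ) (x : Euc d) : ℝ :=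
  sSup {r : ℝ | ∃ φ : Euc d → ℝ, TestFun μ n x φ ∧ r = |∫ y, f y * φ y ∂μ|}

/-- The local class `F_loc(x)`: test functions supported in the cube `Q(x,1)`. -/
def TestFunLoc {d : ℕ} (μ : Measure (Euc d)) (n : ℕ) (x : Euc d) (φ : Euc d → ℝ) : Prop :=
  TestFun μ n x φ ∧ Function.support φ ⊆ (Cube.mk x 1).set

/-- The local grand maximal function `M^{(1)} f(x) = sup_{φ ∈ F_loc(x)} |∫ f φ dμ|`. -/
def grandMLoc {d : ℕ} (μ : Measure (Euc d)) (n : ℕ) (f : Euc d → ℝ) (x : Euc d) : ℝ :=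
  sSup {r : ℝ | ∃ φ : Euc d → ℝ, TestFunLoc μ n x φ ∧ r = |∫ y, f y * φ y ∂μ|}

/-- The Orlicz quasi-norm of `u` on the set `E`, for the Orlicz function `P`
(with value `∞` when no admissible constant exists). -/
def orliczNormOn {α : Type*} [MeasurableSpace α] (P : ℝ → ℝ) (lam : Measure α)
    (E : Set α) (u : α → ℝ) : ℝ≥0∞ :=
  sInf {k : ℝ≥0∞ | 0 < k ∧ k ≠ ∞ ∧
    ∫⁻ x in E, ENNReal.ofReal (P (|u x| / k.toReal)) ∂lam ≤ 1}

/-- The Orlicz quasi-norm of `u`. -/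
def orliczNorm {α : Type*} [MeasurableSpace α] (P : ℝ → ℝ) (lam : Measure α)
    (u : α → ℝ) : ℝ≥0∞ :=
  orliczNormOn P lam Set.univ u

/-- `℘(t) = t / log(e+t)`. -/
def wp (t : ℝ) : ℝ := t / Real.log (Real.exp 1 + t)

/-- `℘̃(t) = t · log(e+t)`. -/
def wpDual (t : ℝ) : ℝ := t * Real.log (Real.exp 1 + t)

/-- `Ξ(t) = e^t − 1`. -/
def XiFun (t : ℝ) : ℝ := Real.exp t - 1

/-- `dν(x) = dμ(x)/log(e+|x|)`. -/
def nuMeas {d : ℕ} (μ : Measure (Euc d)) : Measure (Euc d) :=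
  μ.withDensity fun x => ENNReal.ofReal (Real.log (Real.exp 1 + ‖x‖))⁻¹

/-- `dσ(x) = dμ(x)/(1+|x|)^{2n+κ}`. -/
def sigmaMeas {d : ℕ} (μ : Measure (Euc d)) (n : ℕ) (κ : ℝ) : Measure (Euc d) :=
  μ.withDensity fun x => ENNReal.ofReal (((1 + ‖x‖) ^ (2 * (n : ℝ) + κ))⁻¹)

/-- The unit cube `m + [0,1)^d` of the lattice `ℤ^d`. -/
def latCube (d : ℕ) (m : Fin d → ℤ) : Set (Euc d) :=
  {x : Euc d | ∀ i, (m i : ℝ) ≤ x i ∧ x i < (m i : ℝ) + 1}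

/-- `x` belongs to the support of `μ`. -/
def InSupp {d : ℕ} (μ : Measure (Euc d)) (x : Euc d) : Prop :=
  ∀ r : ℝ, 0 < r → 0 < μ (Metric.ball x r)

/-- The closed cube of center `x` and side length `s`, as a set. -/
def box {d : ℕ} (x : Euc d) (s : ℝ) : Set (Euc d) := (Cube.mk x s).set

section Box

variable {d : ℕ}

lemma mem_box {x y : Euc d} {s : ℝ} : y ∈ box x s ↔ ∀ i, |y i - x i| ≤ s / 2 := Iff.rfl

lemma box_subset_box {x y : Euc d} {s t : ℝ} (h : ∀ i, |x i - y i| ≤ (t - s) / 2) :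
    box x s ⊆ box y t := by
  intro z hz
  rw [mem_box] at hz ⊢
  intro i
  have h1 := hz i
  have h2 := h i
  rw [abs_le] at *
  constructor <;> linarith [h1.1, h1.2, h2.1, h2.2]

lemma box_mono (x : Euc d) {s t : ℝ} (h : s ≤ t) : box x s ⊆ box x t :=
  box_subset_box fun i => by simp; linarith

lemma self_mem_box (x : Euc d) {s : ℝ} (hs : 0 ≤ s) : x ∈ box x s := by
  rw [mem_box]
  intro i
  simpa using by linarith

lemma isClosed_box (x : Euc d) (s : ℝ) : IsClosed (box x s) := by
  have : box x s = ⋂ i, {y : Euc d | |y i - x i| ≤ s / 2} := by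
    ext y
    simp [mem_box]
  rw [this]
  exact isClosed_iInter fun i => isClosed_le (by fun_prop) continuous_const

lemma closedBall_subset_box (x : Euc d) (s : ℝ) : closedBall x (s / 2) ⊆ box x s := by
  intro y hy
  rw [mem_closedBall, dist_eq_norm] at hy
  rw [mem_box]
  intro i
  have := PiLp.norm_apply_le (y - x) i
  rw [Real.norm_eq_abs] at this
  simpa using this.trans hy

lemma box_subset_closedBall (x : Euc d) {s : ℝ} (hs : 0 ≤ s) : box x s ⊆ closedBall x (d * s) := by
  intro y hy
  rw [mem_box] at hy
  rw [mem_closedBall, dist_eq_norm, EuclideanSpace.norm_eq]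
  refine Real.sqrt_le_iff.2 ⟨by positivity, ?_⟩
  calc ∑ i, ‖(y - x) i‖ ^ 2 ≤ ∑ _i : Fin d, s ^ 2 := by
        refine Finset.sum_le_sum fun i _ => ?_
        have := hy i
        have h2 : ‖(y - x) i‖ ≤ s := by
          rw [Real.norm_eq_abs]
          simpa using this.trans (by linarith)
        gcongr
    _ = d * s ^ 2 := by simp
    _ ≤ (d * s) ^ 2 := by
        rw [mul_pow]
        gcongr
        rcases Nat.eq_zero_or_pos d with h | h
        · simp [h]
        · have : (1 : ℝ) ≤ d := by exact_mod_cast h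
          nlinarith

lemma isCompact_box (x : Euc d) {s : ℝ} (hs : 0 ≤ s) : IsCompact (box x s) :=
  (isCompact_closedBall x _).of_isClosed_subset (isClosed_box x s) (box_subset_closedBall x hs)

lemma measurableSet_box (x : Euc d) (s : ℝ) : MeasurableSet (box x s) :=
  (isClosed_box x s).measurableSet

lemma interior_box_nonempty (x : Euc d) {s : ℝ} (hs : 0 < s) : (interior (box x s)).Nonempty :=
  ⟨x, mem_interior.2 ⟨ball x (s / 2), ball_subset_closedBall.trans (closedBall_subset_box x s),
    isOpen_ball, mem_ball_self (by positivity)⟩⟩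

lemma InSupp.measure_box_pos {μ : Measure (Euc d)} {x : Euc d} (hx : InSupp μ x) {s : ℝ}
    (hs : 0 < s) : 0 < μ (box x s) :=
  (hx (s / 2) (by positivity)).trans_le
    (measure_mono (ball_subset_closedBall.trans (closedBall_subset_box x s)))

lemma ae_inSupp (μ : Measure (Euc d)) : ∀ᵐ x ∂μ, InSupp μ x := by
  filter_upwards [Measure.support_mem_ae (μ := μ)] with x hx r hr
  exact Measure.mem_support_iff_forall _ |>.1 hx _ (ball_mem_nhds x hr)

lemma isLocallyFiniteMeasure_of_growth {μ : Measure (Euc d)} {C₀ : ℝ} {n : ℕ}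
    (h : ∀ x : Euc d, ∀ r : ℝ, 0 < r → μ (ball x r) ≤ ENNReal.ofReal (C₀ * r ^ n)) :
    IsLocallyFiniteMeasure μ :=
  ⟨fun x => ⟨ball x 1, ball_mem_nhds x one_pos, (h x 1 one_pos).trans_lt ENNReal.ofReal_lt_top⟩⟩

lemma measure_box_lt_top (μ : Measure (Euc d)) [IsLocallyFiniteMeasure μ] (x : Euc d) {s : ℝ}
    (hs : 0 ≤ s) : μ (box x s) < ∞ :=
  (isCompact_box x hs).measure_lt_top

/-- The measure of a cube, as a real number. -/
def mass (μ : Measure (Euc d)) (x : Euc d) (s : ℝ) : ℝ := (μ (box x s)).toReal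

lemma mass_nonneg (μ : Measure (Euc d)) (x : Euc d) (s : ℝ) : 0 ≤ mass μ x s :=
  ENNReal.toReal_nonneg

lemma ofReal_mass (μ : Measure (Euc d)) [IsLocallyFiniteMeasure μ] (x : Euc d) {s : ℝ}
    (hs : 0 ≤ s) : ENNReal.ofReal (mass μ x s) = μ (box x s) :=
  ENNReal.ofReal_toReal (measure_box_lt_top μ x hs).ne

lemma mass_le_mass {μ : Measure (Euc d)} [IsLocallyFiniteMeasure μ] {x y : Euc d} {s t : ℝ}
    (ht : 0 ≤ t) (h : ∀ i, |x i - y i| ≤ (t - s) / 2) : mass μ x s ≤ mass μ y t :=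
  ENNReal.toReal_mono (measure_box_lt_top μ y ht).ne (measure_mono (box_subset_box h))

lemma mass_mono {μ : Measure (Euc d)} [IsLocallyFiniteMeasure μ] {x : Euc d} {s t : ℝ}
    (ht : 0 ≤ t) (h : s ≤ t) : mass μ x s ≤ mass μ x t :=
  mass_le_mass ht fun i => by simp; linarith

lemma InSupp.mass_pos {μ : Measure (Euc d)} [IsLocallyFiniteMeasure μ] {x : Euc d}
    (hx : InSupp μ x) {s : ℝ} (hs : 0 < s) : 0 < mass μ x s :=
  ENNReal.toReal_pos (hx.measure_box_pos hs).ne' (measure_box_lt_top μ x hs.le).ne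

end Box

/-- A truncated power, describing densities that grow geometrically up to scale `t`. -/
def bump (ε t u : ℝ) : ℝ := if u ≤ t then (u / t) ^ ε else 0

/-- The sum of the geometric series of ratio `2 ^ (-ε)`. -/
def geomConst (ε : ℝ) : ℝ := (1 - 2 ^ (-ε))⁻¹

section Density

variable {d n : ℕ} {μ : Measure (Euc d)}

lemma two_rpow_neg_lt_one {ε : ℝ} (hε : 0 < ε) : (2 : ℝ) ^ (-ε) < 1 :=
  Real.rpow_lt_one_of_one_lt_of_neg one_lt_two (by linarith)

lemma geomConst_pos {ε : ℝ} (hε : 0 < ε) : 0 < geomConst ε :=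
  inv_pos.2 (by linarith [two_rpow_neg_lt_one hε])

lemma bump_nonneg {ε t u : ℝ} (ht : 0 < t) (hu : 0 ≤ u) : 0 ≤ bump ε t u := by
  unfold bump
  split_ifs <;> positivity

lemma sum_bump_le {ε a t : ℝ} (hε : 0 < ε) (ha : 0 < a) (ht : 0 < t) (N : ℕ) :
    ∑ k ∈ Finset.Icc 1 N, bump ε t (2 ^ k * a) ≤ geomConst ε := by
  have hG := geomConst_pos hε
  have hq := two_rpow_neg_lt_one hε
  have key : ∀ N : ℕ, ∑ k ∈ Finset.Icc 1 N, bump ε t (2 ^ k * a) ≤ geomConst ε ∧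
      (2 ^ N * a ≤ t → ∑ k ∈ Finset.Icc 1 N, bump ε t (2 ^ k * a)
        ≤ geomConst ε * (2 ^ N * a / t) ^ ε) := by
    intro N
    induction N with
    | zero =>
      simp only [Finset.Icc_eq_empty_of_lt zero_lt_one, Finset.sum_empty]
      exact ⟨hG.le, fun _ => by positivity⟩
    | succ N ih =>
      rw [Finset.sum_Icc_succ_top (by omega)]
      by_cases h : 2 ^ (N + 1) * a ≤ t
      · have h' : 2 ^ N * a ≤ t := by
          refine le_trans ?_ h
          gcongr
          · norm_num
          · omega
        have h1 := ih.2 h'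
        have hb : bump ε t (2 ^ (N + 1) * a) = (2 ^ (N + 1) * a / t) ^ ε := if_pos h
        have hz : (2 ^ N * a / t) ^ ε = 2 ^ (-ε) * (2 ^ (N + 1) * a / t) ^ ε := by
          have : (2 : ℝ) ^ N * a / t = 2⁻¹ * (2 ^ (N + 1) * a / t) := by
            rw [pow_succ]
            ring
          rw [this, Real.mul_rpow (by norm_num) (by positivity), Real.inv_rpow (by norm_num),
            Real.rpow_neg (by norm_num)]
        have hle : (2 ^ (N + 1) * a / t) ^ ε ≤ 1 :=
          Real.rpow_le_one (by positivity) ((div_le_one ht).2 h) hε.le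
        have hid : geomConst ε * 2 ^ (-ε) + 1 = geomConst ε := by
          unfold geomConst
          have : (1 : ℝ) - 2 ^ (-ε) ≠ 0 := by linarith
          field_simp
          ring
        have hfin : ∑ k ∈ Finset.Icc 1 N, bump ε t (2 ^ k * a) + bump ε t (2 ^ (N + 1) * a)
            ≤ geomConst ε * (2 ^ (N + 1) * a / t) ^ ε := by
          rw [hb]
          rw [hz] at h1
          calc _ ≤ geomConst ε * (2 ^ (-ε) * (2 ^ (N + 1) * a / t) ^ ε)
                + (2 ^ (N + 1) * a / t) ^ ε := by linarith
            _ = (geomConst ε * 2 ^ (-ε) + 1) * (2 ^ (N + 1) * a / t) ^ ε := by ring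
            _ = _ := by rw [hid]
        exact ⟨hfin.trans (mul_le_of_le_one_right hG.le hle), fun _ => hfin⟩
      · have hb : bump ε t (2 ^ (N + 1) * a) = 0 := if_neg h
        rw [hb, add_zero]
        exact ⟨ih.1, fun h' => absurd h' h⟩
  exact (key N).1

/-- Starting from any scale one reaches, after a range of scales along which the density grows
geometrically, a scale at which the measure is doubling. -/
lemma exists_doubling_scale [IsLocallyFiniteMeasure μ] {C₀ α ε : ℝ} (hC₀ : 0 < C₀) (hα : 1 < α)
    (hε : 0 < ε) (hg : ∀ x, InSupp μ x → ∀ s, 0 < s → mass μ x s ≤ C₀ * s ^ n)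
    {x : Euc d} (hx : InSupp μ x) {s : ℝ} (hs : 0 < s) :
    ∃ t, s ≤ t ∧ mass μ x (α * t) ≤ α ^ n * α ^ ε * mass μ x t ∧
      ∀ u, s ≤ u → u ≤ t → mass μ x u ≤ C₀ * α ^ n * α ^ ε * (u / t) ^ ε * u ^ n := by
  have hα0 : 0 < α := by linarith
  have hαε : 1 < α ^ ε := Real.one_lt_rpow hα hε
  set B : ℝ := α ^ n * α ^ ε with hB
  have hB0 : 0 < B := by positivity
  have hex : ∃ k : ℕ, mass μ x (α * (α ^ k * s)) ≤ B * mass μ x (α ^ k * s) := by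
    by_contra! hcon
    have hlow : ∀ k : ℕ, B ^ k * mass μ x s ≤ mass μ x (α ^ k * s) := by
      intro k
      induction k with
      | zero => simp
      | succ k ih =>
        calc B ^ (k + 1) * mass μ x s = B * (B ^ k * mass μ x s) := by ring
          _ ≤ B * mass μ x (α ^ k * s) := by gcongr
          _ ≤ mass μ x (α * (α ^ k * s)) := (hcon k).le
          _ = _ := by congr 1; ring
    have hms := hx.mass_pos hs
    obtain ⟨k, hk⟩ := pow_unbounded_of_one_lt (C₀ * s ^ n / mass μ x s) hαε
    rw [div_lt_iff₀ hms] at hk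
    have h1 := (hlow k).trans (hg x hx (α ^ k * s) (by positivity))
    have h2 : (α ^ n) ^ k * ((α ^ ε) ^ k * mass μ x s) ≤ (α ^ n) ^ k * (C₀ * s ^ n) := by
      calc _ = B ^ k * mass μ x s := by rw [hB]; ring
        _ ≤ _ := h1
        _ = _ := by ring
    have := le_of_mul_le_mul_left h2 (by positivity)
    linarith
  classical
  set k := Nat.find hex with hk
  refine ⟨α ^ k * s, le_mul_of_one_le_left hs.le (one_le_pow₀ hα.le), Nat.find_spec hex, ?_⟩
  have hup : ∀ i : ℕ, i ≤ k → B ^ i * mass μ x (α ^ (k - i) * s) ≤ mass μ x (α ^ k * s) := by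
    intro i
    induction i with
    | zero => intro _; simp
    | succ i ih =>
      intro hi
      have h1 := Nat.find_min hex (m := k - (i + 1)) (by omega)
      push Not at h1
      have h2 : α * (α ^ (k - (i + 1)) * s) = α ^ (k - i) * s := by
        rw [← mul_assoc, ← pow_succ']
        congr 2
        omega
      rw [h2] at h1
      calc _ = B ^ i * (B * mass μ x (α ^ (k - (i + 1)) * s)) := by ring
        _ ≤ B ^ i * mass μ x (α ^ (k - i) * s) := by gcongr
        _ ≤ _ := ih (by omega)
  intro u hsu hut
  have hu : 0 < u := hs.trans_le hsu
  obtain ⟨j, hj1, hj2⟩ := exists_nat_pow_near ((one_le_div hs).2 hsu) hα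
  rw [le_div_iff₀ hs] at hj1
  rw [div_lt_iff₀ hs] at hj2
  by_cases hjk : j < k
  · obtain ⟨i, hi⟩ : ∃ i, k = j + 1 + i := ⟨k - (j + 1), by omega⟩
    have h1 := hup i (by omega)
    have h2 : k - i = j + 1 := by omega
    rw [h2] at h1
    have h3 : B ^ i * mass μ x u ≤ C₀ * (α ^ k * s) ^ n :=
      le_trans (by gcongr; exact mass_mono (by positivity) hj2.le)
        (h1.trans (hg x hx _ (by positivity)))
    have h4 : (α ^ k * s) ^ n ≤ (α ^ n) ^ i * (α ^ n * u ^ n) := by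
      calc (α ^ k * s) ^ n = (α ^ n) ^ i * (α ^ n * (α ^ j * s) ^ n) := by rw [hi]; ring
        _ ≤ _ := by gcongr
    have h5 : (α ^ n) ^ i * ((α ^ ε) ^ i * mass μ x u) ≤ (α ^ n) ^ i * (C₀ * α ^ n * u ^ n) := by
      calc _ = B ^ i * mass μ x u := by rw [hB]; ring
        _ ≤ C₀ * (α ^ k * s) ^ n := h3
        _ ≤ C₀ * ((α ^ n) ^ i * (α ^ n * u ^ n)) := by gcongr
        _ = _ := by ring
    have h6 := le_of_mul_le_mul_left h5 (by positivity)
    have h7 : 1 ≤ (α ^ ε) ^ i * (α ^ ε * (u / (α ^ k * s)) ^ ε) := by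
      have : (α ^ ε) ^ i * (α ^ ε * (u / (α ^ k * s)) ^ ε)
          = (α ^ i * (α * (u / (α ^ k * s)))) ^ ε := by
        rw [Real.mul_rpow (by positivity) (by positivity),
          Real.mul_rpow (by positivity) (by positivity), ← Real.rpow_natCast (α ^ ε) i,
          ← Real.rpow_mul hα0.le, mul_comm ε, Real.rpow_mul hα0.le, Real.rpow_natCast]
      rw [this]
      refine Real.one_le_rpow ?_ hε.le
      have : α ^ i * (α * (u / (α ^ k * s))) = u / (α ^ j * s) := by
        rw [hi]
        field_simp
        ring
      rw [this]
      exact (one_le_div (by positivity)).2 hj1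
    have hm := mass_nonneg μ x u
    calc mass μ x u ≤ mass μ x u * ((α ^ ε) ^ i * (α ^ ε * (u / (α ^ k * s)) ^ ε)) :=
          le_mul_of_one_le_right hm h7
      _ = ((α ^ ε) ^ i * mass μ x u) * (α ^ ε * (u / (α ^ k * s)) ^ ε) := by ring
      _ ≤ (C₀ * α ^ n * u ^ n) * (α ^ ε * (u / (α ^ k * s)) ^ ε) := by gcongr
      _ = _ := by ring
  · have h1 : u = α ^ k * s := by
      refine le_antisymm hut (le_trans ?_ hj1)
      gcongr
      · exact hα.le
      · omega
    rw [← h1, div_self hu.ne', Real.one_rpow, mul_one]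
    have h2 : 1 ≤ α ^ n * α ^ ε := by
      nlinarith [one_le_pow₀ hα.le (n := n)]
    calc mass μ x u ≤ C₀ * u ^ n := hg x hx u hu
      _ ≤ C₀ * u ^ n * (α ^ n * α ^ ε) := le_mul_of_one_le_right (by positivity) h2
      _ = _ := by ring

lemma SQR_le {ε A a b : ℝ} (hε : 0 < ε) (ha : 0 < a) (hab : a ≤ b) (hA : 0 ≤ A)
    {x y : Euc d} {t₁ t₂ t₃ t₄ : ℝ}
    (h₁ : 0 < t₁) (h₂ : 0 < t₂) (h₃ : 0 < t₃) (h₄ : 0 < t₄)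
    (hD : ∀ u, a ≤ u → u ≤ 2 * b →
      (u ≤ t₁ ∧ mass μ x u ≤ A * (u / t₁) ^ ε * u ^ n) ∨
      (u ≤ t₂ ∧ mass μ x u ≤ A * (u / t₂) ^ ε * u ^ n) ∨
      (u ≤ t₃ ∧ mass μ x u ≤ A * (u / t₃) ^ ε * u ^ n) ∨
      (u ≤ t₄ ∧ mass μ x u ≤ A * (u / t₄) ^ ε * u ^ n)) :
    SQR μ n (Cube.mk x a) (Cube.mk y b) ≤ 1 + A * (4 * geomConst ε) := by
  have hD' : ∀ u, a ≤ u → u ≤ 2 * b →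
      mass μ x u ≤ A * (bump ε t₁ u + bump ε t₂ u + bump ε t₃ u + bump ε t₄ u) * u ^ n := by
    intro u hau hub
    have hu : 0 ≤ u := ha.le.trans hau
    have b₁ := bump_nonneg (ε := ε) h₁ hu
    have b₂ := bump_nonneg (ε := ε) h₂ hu
    have b₃ := bump_nonneg (ε := ε) h₃ hu
    have b₄ := bump_nonneg (ε := ε) h₄ hu
    have hle : ∀ {t : ℝ}, u ≤ t → mass μ x u ≤ A * (u / t) ^ ε * u ^ n →
        bump ε t u ≤ bump ε t₁ u + bump ε t₂ u + bump ε t₃ u + bump ε t₄ u →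
        mass μ x u ≤ A * (bump ε t₁ u + bump ε t₂ u + bump ε t₃ u + bump ε t₄ u) * u ^ n := by
      intro t hut hm hb
      have : bump ε t u = (u / t) ^ ε := if_pos hut
      rw [← this] at hm
      exact hm.trans (by gcongr)
    rcases hD u hau hub with h | h | h | h <;> exact hle h.1 h.2 (by linarith)
  unfold SQR
  gcongr
  have hterm : ∀ k ∈ Finset.Icc 1 (NQR (Cube.mk x a) (Cube.mk y b)),
      (μ ((Cube.mk x a).dilate (2 ^ k)).set).toReal / (2 ^ k * a) ^ n
        ≤ A * (bump ε t₁ (2 ^ k * a) + bump ε t₂ (2 ^ k * a) + bump ε t₃ (2 ^ k * a)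
          + bump ε t₄ (2 ^ k * a)) := by
    intro k hk
    rw [Finset.mem_Icc] at hk
    rw [div_le_iff₀ (by positivity)]
    refine hD' (2 ^ k * a) (le_mul_of_one_le_left ha.le (one_le_pow₀ one_le_two)) ?_
    obtain ⟨j, rfl⟩ : ∃ j, k = j + 1 := ⟨k - 1, by omega⟩
    have hj : 2 ^ j * a ≤ b := by
      rcases Nat.eq_zero_or_pos j with rfl | hj
      · simpa using hab
      · by_contra! hcon
        have : NQR (Cube.mk x a) (Cube.mk y b) ≤ j := Nat.sInf_le ⟨hj, hcon.le⟩
        omega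
    rw [pow_succ]
    linarith
  refine (Finset.sum_le_sum hterm).trans ?_
  rw [← Finset.mul_sum]
  gcongr
  simp only [Finset.sum_add_distrib]
  linarith [sum_bump_le hε ha h₁ (NQR (Cube.mk x a) (Cube.mk y b)),
    sum_bump_le hε ha h₂ (NQR (Cube.mk x a) (Cube.mk y b)),
    sum_bump_le hε ha h₃ (NQR (Cube.mk x a) (Cube.mk y b)),
    sum_bump_le hε ha h₄ (NQR (Cube.mk x a) (Cube.mk y b))]

end Density

/-- `p` selects, above each scale at each point of the support, a `(ρ, β)`-doubling scale reached
through a range of scales of geometrically growing density. -/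
structure IsScaleSelector {d : ℕ} (μ : Measure (Euc d)) (n : ℕ) (ρ β A ε : ℝ)
    (p : Euc d → ℝ → ℝ) : Prop where
  le : ∀ x, InSupp μ x → ∀ s, 0 < s → s ≤ p x s
  doubling : ∀ x, InSupp μ x → ∀ s, 0 < s → IsDoubling μ ρ β (Cube.mk x (p x s))
  mass_le : ∀ x, InSupp μ x → ∀ s, 0 < s → ∀ u, s ≤ u → u ≤ p x s →
    mass μ x u ≤ A * (u / p x s) ^ ε * u ^ n

section Averages

variable {d n : ℕ} {μ : Measure (Euc d)} {C₀ η ρ β A ε : ℝ} {p : Euc d → ℝ → ℝ} {f : Euc d → ℝ}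

lemma mass_le_of_le_mul (hC₀ : 0 < C₀) (hε : 0 < ε)
    (hg : ∀ x, InSupp μ x → ∀ s, 0 < s → mass μ x s ≤ C₀ * s ^ n)
    {x : Euc d} (hx : InSupp μ x) {u t l : ℝ} (hu : 0 < u) (ht : 0 < t) (hl : 0 ≤ l)
    (h : t ≤ l * u) : mass μ x u ≤ C₀ * l ^ ε * (u / t) ^ ε * u ^ n := by
  have h1 : 1 ≤ l ^ ε * (u / t) ^ ε := by
    rw [← Real.mul_rpow hl (by positivity)]
    refine Real.one_le_rpow ?_ hε.le
    rw [← mul_div_assoc]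
    exact (one_le_div ht).2 h
  calc mass μ x u ≤ C₀ * u ^ n := hg x hx u hu
    _ ≤ C₀ * u ^ n * (l ^ ε * (u / t) ^ ε) := le_mul_of_one_le_right (by positivity) h1
    _ = _ := by ring

lemma abs_cubeAvg_sub_le (hb : RBMOBound μ n η ρ β f 1) (hε : 0 < ε) {a b : ℝ} (ha : 0 < a)
    (hab : a ≤ b) (hA : 0 ≤ A) {x y : Euc d} (hx : InSupp μ x) (hy : InSupp μ y)
    (hsub : box x a ⊆ box y b) (hda : IsDoubling μ ρ β (Cube.mk x a))
    (hdb : IsDoubling μ ρ β (Cube.mk y b)) {t₁ t₂ t₃ t₄ : ℝ}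
    (h₁ : 0 < t₁) (h₂ : 0 < t₂) (h₃ : 0 < t₃) (h₄ : 0 < t₄)
    (hD : ∀ u, a ≤ u → u ≤ 2 * b →
      (u ≤ t₁ ∧ mass μ x u ≤ A * (u / t₁) ^ ε * u ^ n) ∨
      (u ≤ t₂ ∧ mass μ x u ≤ A * (u / t₂) ^ ε * u ^ n) ∨
      (u ≤ t₃ ∧ mass μ x u ≤ A * (u / t₃) ^ ε * u ^ n) ∨
      (u ≤ t₄ ∧ mass μ x u ≤ A * (u / t₄) ^ ε * u ^ n)) :
    |cubeAvg μ (Cube.mk x a) f - cubeAvg μ (Cube.mk y b) f| ≤ 1 + A * (4 * geomConst ε) := by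
  have h := hb.2 (Cube.mk x a) (Cube.mk y b) ⟨ha, hx⟩ ⟨ha.trans_le hab, hy⟩ hsub hda hdb
  rw [one_mul] at h
  exact h.trans (SQR_le hε ha hab hA h₁ h₂ h₃ h₄ hD)

/-- Averages over selected cubes with a common center are close when the density grows
geometrically between the two scales. -/
lemma IsScaleSelector.abs_sub_le_of_mass_le (hp : IsScaleSelector μ n ρ β A ε p)
    (hb : RBMOBound μ n η ρ β f 1) (hε : 0 < ε) (hC₀ : 0 < C₀)
    (hg : ∀ x, InSupp μ x → ∀ s, 0 < s → mass μ x s ≤ C₀ * s ^ n) {A' : ℝ} (hA' : 0 ≤ A')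
    (hAA' : A ≤ A') (hCA' : C₀ * 2 ^ ε ≤ A') {x : Euc d} (hx : InSupp μ x) {s t : ℝ}
    (hs : 0 < s) (hst : s ≤ t)
    (hgeo : ∀ u, s ≤ u → u ≤ t → mass μ x u ≤ A' * (u / t) ^ ε * u ^ n) :
    |cubeAvg μ (Cube.mk x (p x s)) f - cubeAvg μ (Cube.mk x (p x t)) f|
      ≤ 1 + A' * (4 * geomConst ε) := by
  have ht : 0 < t := hs.trans_le hst
  have hps := hp.le x hx s hs
  have hpt := hp.le x hx t ht
  have hps0 : 0 < p x s := hs.trans_le hps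
  have hpt0 : 0 < p x t := ht.trans_le hpt
  have htop : ∀ q u : ℝ, 0 < q → q < u → u ≤ 2 * q →
      u ≤ 2 * q ∧ mass μ x u ≤ A' * (u / (2 * q)) ^ ε * u ^ n := fun q u hq h1 h2 =>
    have hu : 0 < u := hq.trans h1
    ⟨h2, (mass_le_of_le_mul hC₀ hε hg hx hu (t := 2 * q) (l := 2) (by positivity) zero_le_two
      (by linarith)).trans (by gcongr)⟩
  rcases le_total (p x s) (p x t) with h | h
  · refine abs_cubeAvg_sub_le hb hε hps0 h hA' hx hx (box_mono x h) (hp.doubling x hx s hs)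
      (hp.doubling x hx t ht) ht hpt0 (t₃ := 2 * p x t) (t₄ := 2 * p x t) (by positivity)
      (by positivity) ?_
    intro u h1 h2
    have hu : 0 < u := hps0.trans_le h1
    by_cases h3 : u ≤ t
    · exact Or.inl ⟨h3, hgeo u (hps.trans h1) h3⟩
    by_cases h4 : u ≤ p x t
    · exact Or.inr (Or.inl ⟨h4, (hp.mass_le x hx t ht u (le_of_not_ge h3) h4).trans
        (by gcongr)⟩)
    · exact Or.inr (Or.inr (Or.inl (htop _ u hpt0 (lt_of_not_ge h4) h2)))
  · rw [abs_sub_comm]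
    refine abs_cubeAvg_sub_le hb hε hpt0 h hA' hx hx (box_mono x h) (hp.doubling x hx t ht)
      (hp.doubling x hx s hs) hps0 (t₂ := 2 * p x s) (t₃ := 2 * p x s) (t₄ := 2 * p x s)
      (by positivity) (by positivity) (by positivity) ?_
    intro u h1 h2
    have hu : 0 < u := hpt0.trans_le h1
    by_cases h4 : u ≤ p x s
    · exact Or.inl ⟨h4, (hp.mass_le x hx s hs u (hst.trans (hpt.trans h1)) h4).trans
        (by gcongr)⟩
    · exact Or.inr (Or.inl (htop _ u hps0 (lt_of_not_ge h4) h2))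

variable [IsLocallyFiniteMeasure μ]

lemma exists_isScaleSelector (hC₀ : 0 < C₀) (hρ : 1 < ρ) (hβ : ρ ^ n < β)
    (hg : ∀ x, InSupp μ x → ∀ s, 0 < s → mass μ x s ≤ C₀ * s ^ n) :
    ∃ ε A, 0 < ε ∧ 0 < A ∧ ∃ p, IsScaleSelector μ n ρ β A ε p := by
  have hρ0 : 0 < ρ := by linarith
  have hρn : 0 < ρ ^ n := by positivity
  have h1 : 1 < β / ρ ^ n := (one_lt_div hρn).2 hβ
  set ε := Real.logb ρ (β / ρ ^ n) with hε_def
  have hε : 0 < ε := Real.logb_pos hρ h1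
  have hβ' : ρ ^ n * ρ ^ ε = β := by
    rw [hε_def, Real.rpow_logb hρ0 hρ.ne' (by linarith)]
    field_simp
  have hex : ∀ x s, ∃ t, InSupp μ x → 0 < s → s ≤ t ∧ IsDoubling μ ρ β (Cube.mk x t) ∧
      ∀ u, s ≤ u → u ≤ t → mass μ x u ≤ C₀ * ρ ^ n * ρ ^ ε * (u / t) ^ ε * u ^ n := by
    intro x s
    by_cases h : InSupp μ x ∧ 0 < s
    · obtain ⟨t, h2, h3, h4⟩ := exists_doubling_scale hC₀ hρ hε hg h.1 h.2
      refine ⟨t, fun _ _ => ⟨h2, ?_, h4⟩⟩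
      have ht : 0 < t := h.2.trans_le h2
      rw [hβ'] at h3
      have h5 := ENNReal.ofReal_le_ofReal h3
      rwa [ENNReal.ofReal_mul (hρn.le.trans hβ.le), ofReal_mass μ x (by positivity),
        ofReal_mass μ x ht.le] at h5
    · exact ⟨0, fun h1 h2 => absurd ⟨h1, h2⟩ h⟩
  choose p hp using hex
  exact ⟨ε, C₀ * ρ ^ n * ρ ^ ε, hε, by positivity, p,
    ⟨fun x hx s hs => (hp x s hx hs).1, fun x hx s hs => (hp x s hx hs).2.1,
      fun x hx s hs => (hp x s hx hs).2.2⟩⟩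

lemma IsScaleSelector.abs_sub_le_of_le (hp : IsScaleSelector μ n ρ β A ε p)
    (hb : RBMOBound μ n η ρ β f 1) (hε : 0 < ε) (hC₀ : 0 < C₀)
    (hg : ∀ x, InSupp μ x → ∀ s, 0 < s → mass μ x s ≤ C₀ * s ^ n) (hA : 0 < A)
    {x y : Euc d} (hx : InSupp μ x) (hy : InSupp μ y) {s : ℝ} (hs : 0 < s)
    (hxy : ∀ i, |x i - y i| ≤ s) (hle : p x s ≤ p y s) :
    |cubeAvg μ (Cube.mk x (p x s)) f - cubeAvg μ (Cube.mk y (p y s)) f|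
      ≤ 2 * (1 + (3 ^ n * A + C₀ * 9 ^ ε) * (4 * geomConst ε)) := by
  set A' : ℝ := 3 ^ n * A + C₀ * 9 ^ ε with hA'
  have hA'0 : 0 ≤ A' := by positivity
  have hA1 : 3 ^ n * A ≤ A' := by
    have : 0 ≤ C₀ * (9 : ℝ) ^ ε := by positivity
    linarith
  have hA2 : A ≤ A' := le_trans (le_mul_of_one_le_left hA.le (one_le_pow₀ (by norm_num))) hA1
  have hA3 : C₀ * 9 ^ ε ≤ A' := by
    have : 0 ≤ 3 ^ n * A := by positivity
    linarith
  set P₁ := p x s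
  set P₂ := p y s
  set P₃ := p y (3 * P₂)
  have h1 : s ≤ P₁ := hp.le x hx s hs
  have h2 : s ≤ P₂ := hp.le y hy s hs
  have hP₁ : 0 < P₁ := hs.trans_le h1
  have hP₂ : 0 < P₂ := hs.trans_le h2
  have h3 : 3 * P₂ ≤ P₃ := hp.le y hy _ (by positivity)
  have hP₃ : 0 < P₃ := by linarith
  have hd₃ : IsDoubling μ ρ β (Cube.mk y P₃) := hp.doubling y hy _ (by positivity)
  have hconst : ∀ (z : Euc d) (u t : ℝ), InSupp μ z → 0 < u → 0 < t → u ≤ t → t ≤ 9 * u →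
      u ≤ t ∧ mass μ z u ≤ A' * (u / t) ^ ε * u ^ n := fun z u t hz hu ht hut htu =>
    ⟨hut, (mass_le_of_le_mul hC₀ hε hg hz hu ht (by norm_num) htu).trans (by gcongr)⟩
  have htrans : ∀ u t, s ≤ u → 0 < t → 3 * u ≤ t →
      mass μ y (3 * u) ≤ A * (3 * u / t) ^ ε * (3 * u) ^ n →
      u ≤ t / 3 ∧ mass μ x u ≤ A' * (u / (t / 3)) ^ ε * u ^ n := by
    intro u t hsu ht h3u hm
    have hu : 0 < u := hs.trans_le hsu
    refine ⟨by linarith, ?_⟩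
    calc mass μ x u ≤ mass μ y (3 * u) :=
          mass_le_mass (by positivity) fun i => (hxy i).trans (by linarith)
      _ ≤ A * (3 * u / t) ^ ε * (3 * u) ^ n := hm
      _ = 3 ^ n * A * (u / (t / 3)) ^ ε * u ^ n := by
          rw [show u / (t / 3) = 3 * u / t by field_simp]
          ring
      _ ≤ _ := by gcongr
  have hfirst : |cubeAvg μ (Cube.mk x P₁) f - cubeAvg μ (Cube.mk y P₃) f|
      ≤ 1 + A' * (4 * geomConst ε) := by
    refine abs_cubeAvg_sub_le hb hε hP₁ (by linarith) hA'0 hx hy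
      (box_subset_box fun i => (hxy i).trans (by linarith)) (hp.doubling x hx s hs) hd₃
      (t₁ := P₂ / 3) (t₂ := 3 * P₂) (t₃ := P₃ / 3) (t₄ := 2 * P₃)
      (by positivity) (by positivity) (by positivity) (by positivity) ?_
    intro u hu1 hu2
    have hsu : s ≤ u := h1.trans hu1
    have hu : 0 < u := hs.trans_le hsu
    by_cases c1 : 3 * u ≤ P₂
    · exact Or.inl (htrans u P₂ hsu hP₂ c1 (hp.mass_le y hy s hs _ (by linarith) c1))
    by_cases c2 : u ≤ 3 * P₂
    · exact Or.inr (Or.inl (hconst x u _ hx hu (by positivity) c2 (by linarith)))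
    by_cases c3 : 3 * u ≤ P₃
    · exact Or.inr (Or.inr (Or.inl (htrans u P₃ hsu hP₃ c3
        (hp.mass_le y hy _ (by positivity) _ (by linarith) c3))))
    · exact Or.inr (Or.inr (Or.inr (hconst x u _ hx hu (by positivity) hu2 (by linarith))))
  have hsecond : |cubeAvg μ (Cube.mk y P₂) f - cubeAvg μ (Cube.mk y P₃) f|
      ≤ 1 + A' * (4 * geomConst ε) := by
    refine abs_cubeAvg_sub_le hb hε hP₂ (by linarith) hA'0 hy hy
      (box_mono y (by linarith)) (hp.doubling y hy s hs) hd₃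
      (t₁ := 3 * P₂) (t₂ := P₃) (t₃ := 2 * P₃) (t₄ := 2 * P₃)
      (by positivity) (by positivity) (by positivity) (by positivity) ?_
    intro u hu1 hu2
    have hu : 0 < u := hP₂.trans_le hu1
    by_cases c1 : u ≤ 3 * P₂
    · exact Or.inl (hconst y u _ hy hu (by positivity) c1 (by linarith))
    by_cases c2 : u ≤ P₃
    · exact Or.inr (Or.inl ⟨c2, (hp.mass_le y hy _ (by positivity) u (by linarith) c2).trans
        (by gcongr)⟩)
    · exact Or.inr (Or.inr (Or.inl (hconst y u _ hy hu (by positivity) hu2 (by linarith))))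
  calc _ ≤ |cubeAvg μ (Cube.mk x P₁) f - cubeAvg μ (Cube.mk y P₃) f|
        + |cubeAvg μ (Cube.mk y P₃) f - cubeAvg μ (Cube.mk y P₂) f| := abs_sub_le _ _ _
    _ ≤ _ := by
        rw [abs_sub_comm (cubeAvg μ (Cube.mk y P₃) f)]
        linarith

lemma IsScaleSelector.abs_sub_le (hp : IsScaleSelector μ n ρ β A ε p)
    (hb : RBMOBound μ n η ρ β f 1) (hε : 0 < ε) (hC₀ : 0 < C₀)
    (hg : ∀ x, InSupp μ x → ∀ s, 0 < s → mass μ x s ≤ C₀ * s ^ n) (hA : 0 < A)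
    {x y : Euc d} (hx : InSupp μ x) (hy : InSupp μ y) {s : ℝ} (hs : 0 < s)
    (hxy : ∀ i, |x i - y i| ≤ s) :
    |cubeAvg μ (Cube.mk x (p x s)) f - cubeAvg μ (Cube.mk y (p y s)) f|
      ≤ 2 * (1 + (3 ^ n * A + C₀ * 9 ^ ε) * (4 * geomConst ε)) := by
  rcases le_total (p x s) (p y s) with h | h
  · exact hp.abs_sub_le_of_le hb hε hC₀ hg hA hx hy hs hxy h
  · rw [abs_sub_comm]
    exact hp.abs_sub_le_of_le hb hε hC₀ hg hA hy hx hs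
      (fun i => by rw [abs_sub_comm]; exact hxy i) h

lemma enorm_sub_eq (a b : ℝ) : ‖a - b‖ₑ = ENNReal.ofReal |a - b| := by
  rw [← ofReal_norm, Real.norm_eq_abs]

/-- The mean oscillation bound of a function in `RBMO`, as a lower Lebesgue integral. -/
lemma lintegral_sub_tilde_le (hb : RBMOBound μ n η ρ β f 1) (hf : LocallyIntegrable f μ)
    (hη : 0 < η) {x : Euc d} (hx : InSupp μ x) {s : ℝ} (hs : 0 < s) :
    ∫⁻ y in box x s, ‖f y - cubeAvg μ (tilde μ ρ β (Cube.mk x s)) f‖ₑ ∂μ ≤ μ (box x (η * s)) := by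
  have h := hb.1 (Cube.mk x s) ⟨hs, hx⟩
  have hfint : IntegrableOn (fun y => f y - cubeAvg μ (tilde μ ρ β (Cube.mk x s)) f)
      (box x s) μ :=
    (hf.integrableOn_isCompact (isCompact_box x hs.le)).sub
      (integrableOn_const (measure_box_lt_top μ x hs.le).ne)
  rw [← ofReal_integral_norm_eq_lintegral_enorm hfint]
  rw [one_mul] at h
  exact (ENNReal.ofReal_le_ofReal h).trans_eq (ofReal_mass μ x (by positivity))

lemma IsScaleSelector.lintegral_sub_le (hp : IsScaleSelector μ n ρ β A ε p)
    (hb : RBMOBound μ n η ρ β f 1) (hf : LocallyIntegrable f μ) (hη : 1 < η) (hε : 0 < ε)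
    (hC₀ : 0 < C₀) (hg : ∀ x, InSupp μ x → ∀ s, 0 < s → mass μ x s ≤ C₀ * s ^ n) {A' : ℝ}
    (hA' : 0 ≤ A') (hAA' : A ≤ A') (hCA' : C₀ * 2 ^ ε ≤ A') {x : Euc d} (hx : InSupp μ x) {s : ℝ}
    (hs : 0 < s) :
    ∫⁻ y in box x s, ‖f y - cubeAvg μ (Cube.mk x (p x s)) f‖ₑ ∂μ
      ≤ ENNReal.ofReal (2 + A' * (4 * geomConst ε)) * μ (box x (2 * η * s)) := by
  have hη0 : 0 < η := by linarith
  set P := p x s with hP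
  have hsP : s ≤ P := hp.le x hx s hs
  have hP0 : 0 < P := hs.trans_le hsP
  have hdP : IsDoubling μ ρ β (Cube.mk x P) := hp.doubling x hx s hs
  obtain ⟨i, hi1, hi2⟩ := exists_nat_pow_near ((one_le_div hs).2 hsP) one_lt_two
  rw [le_div_iff₀ hs] at hi1
  rw [div_lt_iff₀ hs] at hi2
  set r : ℝ := P / 2 ^ i with hr
  have hr0 : 0 < r := by positivity
  have hsr : s ≤ r := by
    rw [hr, le_div_iff₀ (by positivity)]
    linarith
  have hr2 : r ≤ 2 * s := by
    rw [hr, div_le_iff₀ (by positivity)]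
    rw [pow_succ] at hi2
    linarith
  have hmem : i ∈ {N : ℕ | IsDoubling μ ρ β ((Cube.mk x r).dilate (2 ^ N))} := by
    have : (Cube.mk x r).dilate (2 ^ i) = Cube.mk x P := by
      simp only [Cube.dilate, hr]
      congr 1
      field_simp
    rw [Set.mem_ofPred_eq, this]
    exact hdP
  set N := sInf {N : ℕ | IsDoubling μ ρ β ((Cube.mk x r).dilate (2 ^ N))} with hN
  have hNi : N ≤ i := Nat.sInf_le hmem
  set a : ℝ := 2 ^ N * r with ha
  have hda : IsDoubling μ ρ β (Cube.mk x a) := Nat.sInf_mem ⟨i, hmem⟩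
  have htilde : tilde μ ρ β (Cube.mk x r) = Cube.mk x a := rfl
  have ha0 : 0 < a := by positivity
  have hra : r ≤ a := le_mul_of_one_le_left hr0.le (one_le_pow₀ one_le_two)
  have haP : a ≤ P := by
    calc a ≤ 2 ^ i * r := by
          rw [ha]
          gcongr
          norm_num
      _ = P := by rw [hr]; field_simp
  have hdiff : |cubeAvg μ (Cube.mk x a) f - cubeAvg μ (Cube.mk x P) f|
      ≤ 1 + A' * (4 * geomConst ε) := by
    refine abs_cubeAvg_sub_le hb hε ha0 haP hA' hx hx (box_mono x haP) hda hdP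
      (t₁ := P) (t₂ := 2 * P) (t₃ := P) (t₄ := P) hP0 (by positivity) hP0 hP0 ?_
    intro u h1 h2
    have hu : 0 < u := ha0.trans_le h1
    by_cases h3 : u ≤ P
    · exact Or.inl ⟨h3, (hp.mass_le x hx s hs u (hsr.trans (hra.trans h1)) h3).trans
        (by gcongr)⟩
    · exact Or.inr (Or.inl ⟨h2, (mass_le_of_le_mul hC₀ hε hg hx hu (t := 2 * P) (l := 2) (by positivity)
        zero_le_two (by linarith)).trans (by gcongr)⟩)
  have h1 := lintegral_sub_tilde_le hb hf hη0 hx hr0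
  rw [htilde] at h1
  have hbox1 : μ (box x (η * r)) ≤ μ (box x (2 * η * s)) :=
    measure_mono (box_mono x (by nlinarith))
  have hbox2 : μ (box x r) ≤ μ (box x (2 * η * s)) :=
    measure_mono (box_mono x (by nlinarith))
  have hG := geomConst_pos hε
  calc ∫⁻ y in box x s, ‖f y - cubeAvg μ (Cube.mk x P) f‖ₑ ∂μ
      ≤ ∫⁻ y in box x r, ‖f y - cubeAvg μ (Cube.mk x P) f‖ₑ ∂μ :=
        lintegral_mono_set (box_mono x hsr)
    _ ≤ ∫⁻ y in box x r, (‖f y - cubeAvg μ (Cube.mk x a) f‖ₑ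
          + ENNReal.ofReal (1 + A' * (4 * geomConst ε))) ∂μ := by
        refine lintegral_mono fun y => ?_
        have : f y - cubeAvg μ (Cube.mk x P) f = (f y - cubeAvg μ (Cube.mk x a) f)
            + (cubeAvg μ (Cube.mk x a) f - cubeAvg μ (Cube.mk x P) f) := by ring
        rw [this]
        refine (enorm_add_le _ _).trans ?_
        gcongr
        rw [enorm_sub_eq]
        exact ENNReal.ofReal_le_ofReal hdiff
    _ = ∫⁻ y in box x r, ‖f y - cubeAvg μ (Cube.mk x a) f‖ₑ ∂μ
          + ENNReal.ofReal (1 + A' * (4 * geomConst ε)) * μ (box x r) := by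
        rw [lintegral_add_right _ measurable_const, setLIntegral_const]
    _ ≤ μ (box x (2 * η * s))
          + ENNReal.ofReal (1 + A' * (4 * geomConst ε)) * μ (box x (2 * η * s)) := by
        gcongr
        exact h1.trans hbox1
    _ = _ := by
        rw [show 2 + A' * (4 * geomConst ε) = 1 + (1 + A' * (4 * geomConst ε)) by ring,
          ENNReal.ofReal_add zero_le_one (q := 1 + A' * (4 * geomConst ε)) (by positivity),
          ENNReal.ofReal_one, add_mul, one_mul]

end Averages

lemma abs_sub_le_of_lintegral_le {d : ℕ} {μ : Measure (Euc d)} {f : Euc d → ℝ} {E : Set (Euc d)}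
    (hf : AEStronglyMeasurable f μ) (h0 : μ E ≠ 0) (htop : μ E ≠ ∞) {a b M : ℝ} (hM : 0 ≤ M)
    (h : ∫⁻ y in E, ‖f y - a‖ₑ ∂μ + ∫⁻ y in E, ‖f y - b‖ₑ ∂μ ≤ ENNReal.ofReal M * μ E) :
    |a - b| ≤ M := by
  have hmeas : AEMeasurable (fun y => ‖f y - a‖ₑ) (μ.restrict E) :=
    ((hf.sub aestronglyMeasurable_const).enorm).restrict
  rw [← lintegral_add_left' hmeas] at h
  have h3 : ENNReal.ofReal |a - b| * μ E ≤ ENNReal.ofReal M * μ E := by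
    refine le_trans ?_ h
    rw [← enorm_sub_eq, ← setLIntegral_const]
    refine lintegral_mono fun y => ?_
    have : a - b = -(f y - a) + (f y - b) := by ring
    rw [this]
    refine (enorm_add_le _ _).trans ?_
    rw [enorm_neg]
  exact (ENNReal.ofReal_le_ofReal_iff hM).1 ((ENNReal.mul_le_mul_iff_left h0 htop).1 h3)

section Differentiation

variable {d : ℕ} {μ : Measure (Euc d)} [IsLocallyFiniteMeasure μ]

/-- Almost every point is the center of arbitrarily small balls which are doubling with a constant
exceeding the dimensional one. -/
lemma ae_exists_doubling_closedBall (μ : Measure (Euc d)) [IsLocallyFiniteMeasure μ] {Λ : ℝ}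
    (hΛ : 1 < Λ) :
    ∀ᵐ x ∂μ, ∀ δ : ℝ, 0 < δ → ∃ r, 0 < r ∧ r < δ ∧
      μ (closedBall x (Λ * r)) ≤ ENNReal.ofReal (Λ ^ (d + 1)) * μ (closedBall x r) := by
  have hΛ0 : 0 < Λ := by linarith
  filter_upwards [Besicovitch.ae_tendsto_rnDeriv (volume : Measure (Euc d)) μ,
    Measure.rnDeriv_lt_top (volume : Measure (Euc d)) μ] with x hx hlt δ hδ
  by_contra! hcon
  set L := (volume : Measure (Euc d)).rnDeriv μ x
  have hL : L < L + 1 := ENNReal.lt_add_right hlt.ne one_ne_zero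
  have hLtop : L + 1 ≠ ∞ := ENNReal.add_ne_top.2 ⟨hlt.ne, ENNReal.one_ne_top⟩
  obtain ⟨δ', hδ', hsmall⟩ := mem_nhdsGT_iff_exists_Ioo_subset.1 (hx.eventually (gt_mem_nhds hL))
  have hδ'0 : 0 < δ' := hδ'
  have hfin : ∀ r, μ (closedBall x r) ≠ ∞ := fun r => measure_closedBall_lt_top.ne
  have hvol : ∀ r, 0 < r → r < δ' →
      r ^ d * (volume : Measure (Euc d)).real (ball 0 1)
        ≤ (L + 1).toReal * μ.real (closedBall x r) := by
    intro r hr hrδ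
    have h1 : volume (closedBall x r) / μ (closedBall x r) ≤ L + 1 := (hsmall ⟨hr, hrδ⟩).le
    rw [ENNReal.div_le_iff_le_mul (Or.inr hLtop) (Or.inr (by simp)),
      Measure.addHaar_closedBall _ _ hr.le, finrank_euclideanSpace_fin] at h1
    have h2 := ENNReal.toReal_mono (ENNReal.mul_ne_top hLtop (hfin r)) h1
    rwa [ENNReal.toReal_mul, ENNReal.toReal_mul, ENNReal.toReal_ofReal (by positivity)] at h2
  have hstep : ∀ r, 0 < r → r < δ →
      Λ ^ (d + 1) * μ.real (closedBall x r) ≤ μ.real (closedBall x (Λ * r)) := by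
    intro r hr hrδ
    have h2 := ENNReal.toReal_mono (hfin _) (hcon r hr hrδ).le
    rwa [ENNReal.toReal_mul, ENNReal.toReal_ofReal (by positivity)] at h2
  set r₀ := min δ δ' / 2 with hr₀_def
  have hr₀ : 0 < r₀ := by positivity
  have hr₀1 : r₀ < δ := by
    have := min_le_left δ δ'
    linarith
  have hr₀2 : r₀ < δ' := by
    have := min_le_right δ δ'
    linarith
  have hle : ∀ k : ℕ, r₀ / Λ ^ k ≤ r₀ := fun k => div_le_self hr₀.le (one_le_pow₀ hΛ.le)
  have hiter : ∀ k : ℕ, (Λ ^ (d + 1)) ^ k * μ.real (closedBall x (r₀ / Λ ^ k))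
      ≤ μ.real (closedBall x r₀) := by
    intro k
    induction k with
    | zero => simp
    | succ k ih =>
      refine le_trans ?_ ih
      have h1 := hstep (r₀ / Λ ^ (k + 1)) (by positivity) ((hle _).trans_lt hr₀1)
      rw [show Λ * (r₀ / Λ ^ (k + 1)) = r₀ / Λ ^ k by
        rw [pow_succ]
        field_simp] at h1
      rw [pow_succ (Λ ^ (d + 1)) k, mul_assoc]
      gcongr
  have hV : 0 < (volume : Measure (Euc d)).real (ball 0 1) :=
    ENNReal.toReal_pos (measure_ball_pos _ _ one_pos).ne' measure_ball_lt_top.ne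
  set V := (volume : Measure (Euc d)).real (ball 0 1)
  obtain ⟨k, hk⟩ := pow_unbounded_of_one_lt
    ((L + 1).toReal * μ.real (closedBall x r₀) / (r₀ ^ d * V)) hΛ
  rw [div_lt_iff₀ (by positivity)] at hk
  have h1 := hvol (r₀ / Λ ^ k) (by positivity) ((hle k).trans_lt hr₀2)
  have h2 : (Λ ^ (d + 1)) ^ k * ((r₀ / Λ ^ k) ^ d * V)
      ≤ (L + 1).toReal * μ.real (closedBall x r₀) := by
    calc _ ≤ (Λ ^ (d + 1)) ^ k * ((L + 1).toReal * μ.real (closedBall x (r₀ / Λ ^ k))) := by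
          gcongr
      _ = (L + 1).toReal * ((Λ ^ (d + 1)) ^ k * μ.real (closedBall x (r₀ / Λ ^ k))) := by ring
      _ ≤ _ := by
          gcongr
          exact hiter k
  have h3 : (Λ ^ (d + 1)) ^ k * ((r₀ / Λ ^ k) ^ d * V) = Λ ^ k * (r₀ ^ d * V) := by
    rw [div_pow, ← pow_mul, ← pow_mul, add_mul, one_mul, pow_add, mul_comm d k]
    field_simp
  linarith

/-- If the oscillation of `f` about `m` is controlled on all boxes, then almost everywhere `f` is
approximated by `m` at arbitrarily small scales. -/
lemma ae_exists_abs_sub_le (hd : 1 ≤ d) {f : Euc d → ℝ} (hf : LocallyIntegrable f μ)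
    {m : Euc d → ℝ → ℝ} {K C : ℝ} (hK : 1 ≤ K) (hC : 0 ≤ C)
    (h : ∀ x, InSupp μ x → ∀ s, 0 < s →
      ∫⁻ y in box x s, ‖f y - m x s‖ₑ ∂μ ≤ ENNReal.ofReal C * μ (box x (K * s))) :
    ∀ᵐ x ∂μ, ∀ δ : ℝ, 0 < δ → ∃ s, 0 < s ∧ s < δ ∧
      |f x - m x s| ≤ 1 + C * (2 * d * K) ^ (d + 1) := by
  have hd' : (1 : ℝ) ≤ d := by exact_mod_cast hd
  have hΛ : 1 < 2 * d * K := by nlinarith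
  filter_upwards [ae_inSupp μ, ae_exists_doubling_closedBall μ hΛ,
    (Besicovitch.vitaliFamily μ).ae_tendsto_lintegral_enorm_sub_div hf] with x hx hdoub hleb δ hδ
  have hlim := hleb.comp (Besicovitch.tendsto_filterAt μ x)
  obtain ⟨δ', hδ', hsmall⟩ :=
    mem_nhdsGT_iff_exists_Ioo_subset.1 (hlim.eventually (gt_mem_nhds zero_lt_one))
  have hδ'0 : 0 < δ' := hδ'
  obtain ⟨r, hr, hrδ, hball⟩ := hdoub (min (δ / 2) δ') (by positivity)
  have hr1 : r < δ / 2 := hrδ.trans_le (min_le_left _ _)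
  have hr2 : r < δ' := hrδ.trans_le (min_le_right _ _)
  refine ⟨2 * r, by positivity, by linarith, ?_⟩
  have hpos : μ (closedBall x r) ≠ 0 :=
    ((hx r hr).trans_le (measure_mono ball_subset_closedBall)).ne'
  have hfin : μ (closedBall x r) ≠ ∞ := measure_closedBall_lt_top.ne
  have h1 : ∫⁻ y in closedBall x r, ‖f y - f x‖ₑ ∂μ ≤ 1 * μ (closedBall x r) := by
    have : (∫⁻ y in closedBall x r, ‖f y - f x‖ₑ ∂μ) / μ (closedBall x r) ≤ 1 :=
      (hsmall ⟨hr, hr2⟩).le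
    rwa [ENNReal.div_le_iff_le_mul (Or.inl hpos) (Or.inl hfin)] at this
  have h2 : ∫⁻ y in closedBall x r, ‖f y - m x (2 * r)‖ₑ ∂μ
      ≤ ENNReal.ofReal (C * (2 * d * K) ^ (d + 1)) * μ (closedBall x r) := by
    calc _ ≤ ∫⁻ y in box x (2 * r), ‖f y - m x (2 * r)‖ₑ ∂μ := by
          refine lintegral_mono_set ?_
          have := closedBall_subset_box x (2 * r)
          rwa [mul_div_cancel_left₀ r two_ne_zero] at this
      _ ≤ ENNReal.ofReal C * μ (box x (K * (2 * r))) := h x hx _ (by positivity)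
      _ ≤ ENNReal.ofReal C * μ (closedBall x (2 * d * K * r)) := by
          gcongr
          refine (box_subset_closedBall x (by positivity)).trans_eq ?_
          congr 1
          ring
      _ ≤ ENNReal.ofReal C * (ENNReal.ofReal ((2 * d * K) ^ (d + 1)) * μ (closedBall x r)) := by
          gcongr
      _ = _ := by rw [ENNReal.ofReal_mul hC, mul_assoc (ENNReal.ofReal C)]
  refine abs_sub_le_of_lintegral_le hf.aestronglyMeasurable hpos hfin (by positivity)
    ((add_le_add h1 h2).trans_eq ?_)
  rw [ENNReal.ofReal_add zero_le_one (by positivity), ENNReal.ofReal_one, add_mul]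

end Differentiation

/-- `m` assigns to each box a value about which `f` has controlled oscillation, which varies slowly
between comparable boxes, does not vary until a doubling scale, and approximates `f` at small
scales. -/
structure OscControl {d : ℕ} (μ : Measure (Euc d)) (f : Euc d → ℝ) (m : Euc d → ℝ → ℝ)
    (K C : ℝ) : Prop where
  osc : ∀ x, InSupp μ x → ∀ s, 0 < s →
    ∫⁻ y in box x s, ‖f y - m x s‖ₑ ∂μ ≤ ENNReal.ofReal C * μ (box x (K * s))
  scale : ∀ x, InSupp μ x → ∀ s t, 0 < s → s ≤ t → t ≤ 5 * s → |m x s - m x t| ≤ C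
  point : ∀ x y, InSupp μ x → InSupp μ y → ∀ s, 0 < s → (∀ i, |x i - y i| ≤ s) →
    |m x s - m y s| ≤ C
  doubling : ∀ x, InSupp μ x → ∀ s, 0 < s → ∃ t, s ≤ t ∧
    μ (box x (10 * K * t)) ≤ ENNReal.ofReal C * μ (box x t) ∧
    ∀ s', s ≤ s' → s' ≤ t → |m x s' - m x t| ≤ C
  approx : ∀ᵐ x ∂μ, ∀ δ : ℝ, 0 < δ → ∃ s, 0 < s ∧ s < δ ∧ |f x - m x s| ≤ C

/-- Functions in the unit ball of `RBMO` have uniformly controlled oscillation. -/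
lemma exists_oscControl {d n : ℕ} {μ : Measure (Euc d)} [IsLocallyFiniteMeasure μ]
    {C₀ η ρ β : ℝ} (hd : 1 ≤ d) (hC₀ : 0 < C₀) (hη : 1 < η) (hρ : 1 < ρ) (hβ : ρ ^ n < β)
    (hg : ∀ x, InSupp μ x → ∀ s, 0 < s → mass μ x s ≤ C₀ * s ^ n) (h0 : InSupp μ (0 : Euc d)) :
    ∃ K C : ℝ, 1 ≤ K ∧ 1 ≤ C ∧ ∀ f : Euc d → ℝ, LocallyIntegrable f μ →
      RBMOBound μ n η ρ β f 1 → ∃ m, OscControl μ f m K C ∧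
        |cubeAvg μ (tilde μ ρ β (Cube.mk (0 : Euc d) 1)) f - m 0 1| ≤ C := by
  obtain ⟨ε, A, hε, hA, p, hp⟩ := exists_isScaleSelector hC₀ hρ hβ hg
  have hG := geomConst_pos hε
  set K : ℝ := 2 * η with hK_def
  have hK : 1 ≤ K := by linarith
  set α : ℝ := 10 * K with hα_def
  have hα : 1 < α := by linarith
  have hα0 : 0 < α := by linarith
  set D : ℝ := α ^ n * α ^ ε with hD_def
  have hD : 0 < D := by positivity
  set A' : ℝ := C₀ * D + (3 ^ n * A + C₀ * 9 ^ ε) with hA'_def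
  have hp3 : 0 < 3 ^ n * A := by positivity
  have hp9 : 0 < C₀ * (9 : ℝ) ^ ε := by positivity
  have hpD : 0 < C₀ * D := by positivity
  have hA' : 0 < A' := by positivity
  have h3A : A ≤ 3 ^ n * A := le_mul_of_one_le_left hA.le (one_le_pow₀ (by norm_num))
  have hAA' : A ≤ A' := by linarith
  have h2 : C₀ * (2 : ℝ) ^ ε ≤ C₀ * 9 ^ ε := by gcongr; norm_num
  have h5 : C₀ * (5 : ℝ) ^ ε ≤ C₀ * 9 ^ ε := by gcongr; norm_num
  have hCA' : C₀ * 2 ^ ε ≤ A' := by linarith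
  set C₂ : ℝ := 2 * (1 + A' * (4 * geomConst ε)) with hC₂_def
  have hC₂ : 0 < C₂ := by positivity
  have hm1 : 0 < mass μ 0 1 := h0.mass_pos one_pos
  set C₃ : ℝ := 1 + C₂ * (2 * d * K) ^ (d + 1) with hC₃_def
  have hC₃ : 1 ≤ C₃ := by
    have : 0 ≤ C₂ * (2 * d * K) ^ (d + 1) := by positivity
    linarith
  set C₄ : ℝ := (1 + C₂) * mass μ 0 (2 * η) / mass μ 0 1 with hC₄_def
  have hC₄ : 0 ≤ C₄ := by
    have := mass_nonneg (μ := μ) (0 : Euc d) (2 * η)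
    positivity
  have hle1 : 1 + A' * (4 * geomConst ε) ≤ C₂ := by
    have : 0 < A' * (4 * geomConst ε) := by positivity
    linarith
  have hosc : ∀ f : Euc d → ℝ, LocallyIntegrable f μ → RBMOBound μ n η ρ β f 1 →
      ∀ x, InSupp μ x → ∀ s, 0 < s → ∫⁻ y in box x s, ‖f y - cubeAvg μ (Cube.mk x (p x s)) f‖ₑ ∂μ
        ≤ ENNReal.ofReal C₂ * μ (box x (K * s)) := by
    intro f hf hb x hx s hs
    refine (hp.lintegral_sub_le hb hf hη hε hC₀ hg hA'.le hAA' hCA' hx hs).trans ?_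
    gcongr
    have : 0 < A' * (4 * geomConst ε) := by positivity
    linarith
  refine ⟨K, C₂ + D + C₃ + C₄, hK, by linarith, fun f hf hb =>
    ⟨fun x s => cubeAvg μ (Cube.mk x (p x s)) f, ⟨?_, ?_, ?_, ?_, ?_⟩, ?_⟩⟩
  · intro x hx s hs
    refine (hosc f hf hb x hx s hs).trans ?_
    gcongr
    linarith
  · intro x hx s t hs hst ht5
    have ht : 0 < t := hs.trans_le hst
    refine (hp.abs_sub_le_of_mass_le hb hε hC₀ hg hA'.le hAA' hCA' hx hs hst ?_).trans
      (by linarith)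
    intro u hu1 hu2
    have hu : 0 < u := hs.trans_le hu1
    refine (mass_le_of_le_mul hC₀ hε hg hx hu ht (l := 5) (by norm_num) (by linarith)).trans ?_
    gcongr
    linarith
  · intro x y hx hy s hs hxy
    refine (hp.abs_sub_le hb hε hC₀ hg hA hx hy hs hxy).trans ?_
    have : (3 ^ n * A + C₀ * 9 ^ ε) * (4 * geomConst ε) ≤ A' * (4 * geomConst ε) := by
      gcongr
      linarith
    linarith
  · intro x hx s hs
    obtain ⟨t, hst, hdt, hgeo⟩ := exists_doubling_scale hC₀ hα hε hg hx hs
    have ht : 0 < t := hs.trans_le hst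
    refine ⟨t, hst, ?_, ?_⟩
    · rw [← ofReal_mass μ x (by positivity), ← ofReal_mass μ x ht.le,
        ← ENNReal.ofReal_mul (by positivity)]
      refine ENNReal.ofReal_le_ofReal (hdt.trans ?_)
      have := mass_nonneg (μ := μ) x t
      gcongr
      linarith
    · intro s' hs1 hs2
      have hs' : 0 < s' := hs.trans_le hs1
      refine (hp.abs_sub_le_of_mass_le hb hε hC₀ hg hA'.le hAA' hCA' hx hs' hs2 ?_).trans
        (by linarith)
      intro u hu1 hu2
      have hu : 0 < u := hs'.trans_le hu1
      refine (hgeo u (hs1.trans hu1) hu2).trans ?_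
      have : C₀ * α ^ n * α ^ ε ≤ A' := by
        rw [mul_assoc]
        linarith
      gcongr
  · filter_upwards [ae_exists_abs_sub_le hd hf hK hC₂.le (hosc f hf hb)] with x hx δ hδ
    obtain ⟨s, h1, h2, h3⟩ := hx δ hδ
    exact ⟨s, h1, h2, h3.trans (by linarith)⟩
  · refine (abs_sub_le_of_lintegral_le (E := box 0 1) hf.aestronglyMeasurable
      (h0.measure_box_pos one_pos).ne' (measure_box_lt_top μ _ zero_le_one).ne hC₄ ?_).trans
      (by linarith)
    refine (add_le_add (lintegral_sub_tilde_le hb hf (by linarith) h0 one_pos)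
      (hosc f hf hb 0 h0 1 one_pos)).trans ?_
    rw [mul_one, mul_one, ← ofReal_mass μ 0 (by linarith), ← ofReal_mass μ 0 (s := K) (by linarith),
      ← ofReal_mass μ 0 (s := 1) zero_le_one, ← ENNReal.ofReal_mul hC₂.le,
      ← ENNReal.ofReal_mul hC₄, ← ENNReal.ofReal_add (mass_nonneg _ _ _)
        (mul_nonneg hC₂.le (mass_nonneg _ _ _)), hC₄_def, div_mul_cancel₀ _ hm1.ne', add_mul, one_mul]
    refine ENNReal.ofReal_le_ofReal ?_
    gcongr
    exact mass_mono (by linarith) (by linarith)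

section JohnNirenberg

variable {d : ℕ} {μ : Measure (Euc d)} {f : Euc d → ℝ} {m : Euc d → ℝ → ℝ} {K C : ℝ}

/-- A Calderón–Zygmund stopping time argument: a point where `f` is far from the value attached
to a box is the center of a smaller doubling box whose value is moderately far. -/
lemma OscControl.exists_stopping_scale (h : OscControl μ f m K C) {L : ℝ} (hL : 3 * C ≤ L)
    {z x : Euc d} (hz : InSupp μ z) (hx : InSupp μ x) {l : ℝ} (hl : 0 < l) (hxz : x ∈ box z l)
    (happ : ∀ δ : ℝ, 0 < δ → ∃ s, 0 < s ∧ s < δ ∧ |f x - m x s| ≤ C)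
    (hfar : L + C < |f x - m z l|) :
    ∃ t, 0 < t ∧ t ≤ l ∧ μ (box x (10 * K * t)) ≤ ENNReal.ofReal C * μ (box x t) ∧
      L - C < |m x t - m z l| ∧ |m x t - m z l| ≤ L + 2 * C := by
  obtain ⟨s₀, hs₀, hs₀l, hfs₀⟩ := happ l hl
  have hC : 0 ≤ C := (abs_nonneg _).trans hfs₀
  have hstart : L < |m x s₀ - m z l| := by
    have := abs_sub_le (f x) (m x s₀) (m z l)
    linarith
  have hxl : |m x l - m z l| ≤ C :=
    h.point x z hx hz l hl fun i => (hxz i).trans (half_le_self hl.le)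
  obtain ⟨i, hi1, hi2⟩ := exists_nat_pow_near ((one_le_div hs₀).2 hs₀l.le) one_lt_two
  rw [le_div_iff₀ hs₀] at hi1
  rw [div_lt_iff₀ hs₀, pow_succ] at hi2
  have hend : |m x (2 ^ i * s₀) - m z l| ≤ L := by
    have h1 := h.scale x hx (2 ^ i * s₀) l (by positivity) hi1 (by nlinarith)
    have h2 := abs_sub_le (m x (2 ^ i * s₀)) (m x l) (m z l)
    linarith
  have hex : ∃ i : ℕ, |m x (2 ^ i * s₀) - m z l| ≤ L := ⟨i, hend⟩
  classical
  obtain ⟨k, hk⟩ : ∃ k, Nat.find hex = k + 1 := by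
    refine Nat.exists_eq_succ_of_ne_zero fun h0 => ?_
    have := Nat.find_spec hex
    rw [h0, pow_zero, one_mul] at this
    linarith
  have hk1 : L < |m x (2 ^ k * s₀) - m z l| :=
    lt_of_not_ge (Nat.find_min hex (m := k) (by omega))
  have hk2 : |m x (2 ^ (k + 1) * s₀) - m z l| ≤ L := hk ▸ Nat.find_spec hex
  have hki : k ≤ i := by
    have := Nat.find_min' hex hend
    omega
  set s : ℝ := 2 ^ k * s₀ with hs_def
  have hs : 0 < s := by positivity
  have hsl : s ≤ l := by
    refine le_trans ?_ hi1
    rw [hs_def]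
    gcongr
    norm_num
  have hk3 : |m x s - m z l| ≤ L + C := by
    have h1 := h.scale x hx s (2 ^ (k + 1) * s₀) hs (by rw [pow_succ]; nlinarith)
      (by rw [pow_succ]; nlinarith)
    have h2 := abs_sub_le (m x s) (m x (2 ^ (k + 1) * s₀)) (m z l)
    linarith
  obtain ⟨t, hst, hdt, hmt⟩ := h.doubling x hx s hs
  have hmst := hmt s le_rfl hst
  have hlow : L - C < |m x t - m z l| := by
    have := abs_sub_le (m x s) (m x t) (m z l)
    linarith
  refine ⟨t, hs.trans_le hst, ?_, hdt, hlow, ?_⟩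
  · by_contra! hlt
    have h1 := hmt l hsl hlt.le
    rw [abs_sub_comm] at h1
    have := abs_sub_le (m x t) (m x l) (m z l)
    linarith
  · rw [abs_sub_comm] at hmst
    have := abs_sub_le (m x t) (m x s) (m z l)
    linarith

lemma OscControl.lintegral_double_le (h : OscControl μ f m K C) (hK : 1 ≤ K) {z : Euc d}
    (hz : InSupp μ z) {l : ℝ} (hl : 0 < l) :
    ∫⁻ y in box z (2 * l), ‖f y - m z l‖ₑ ∂μ
      ≤ 2 * ENNReal.ofReal C * μ (box z (2 * K * l)) := by
  have hbox : μ (box z (2 * l)) ≤ μ (box z (2 * K * l)) :=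
    measure_mono (box_mono z (by nlinarith))
  calc _ ≤ ∫⁻ y in box z (2 * l), (‖f y - m z (2 * l)‖ₑ + ENNReal.ofReal C) ∂μ := by
        refine lintegral_mono fun y => ?_
        have : f y - m z l = (f y - m z (2 * l)) + (m z (2 * l) - m z l) := by ring
        rw [this]
        refine (enorm_add_le _ _).trans ?_
        gcongr
        rw [enorm_sub_eq, abs_sub_comm]
        exact ENNReal.ofReal_le_ofReal (h.scale z hz l (2 * l) hl (by linarith) (by linarith))
    _ = ∫⁻ y in box z (2 * l), ‖f y - m z (2 * l)‖ₑ ∂μ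
          + ENNReal.ofReal C * μ (box z (2 * l)) := by
        rw [lintegral_add_right _ measurable_const, setLIntegral_const]
    _ ≤ ENNReal.ofReal C * μ (box z (2 * K * l))
          + ENNReal.ofReal C * μ (box z (2 * K * l)) := by
        gcongr
        rw [show 2 * K * l = K * (2 * l) by ring]
        exact h.osc z hz _ (by positivity)
    _ = _ := by rw [two_mul (ENNReal.ofReal C), add_mul]

variable [IsLocallyFiniteMeasure μ]

lemma OscControl.measure_le_lintegral (h : OscControl μ f m K C) (hf : AEStronglyMeasurable f μ)
    (hK : 1 ≤ K) (hC : 1 ≤ C) {x : Euc d} (hx : InSupp μ x) {t c : ℝ} (ht : 0 < t)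
    (hdt : μ (box x (10 * K * t)) ≤ ENNReal.ofReal C * μ (box x t))
    (hc : 5 * C ^ 2 ≤ |m x t - c|) :
    ENNReal.ofReal (4 * C ^ 2) * μ (box x t) ≤ ∫⁻ y in box x t, ‖f y - c‖ₑ ∂μ := by
  have hC0 : 0 ≤ C := by linarith
  have hfin : ENNReal.ofReal (C ^ 2) * μ (box x t) ≠ ∞ :=
    ENNReal.mul_ne_top ENNReal.ofReal_ne_top (measure_box_lt_top μ x ht.le).ne
  refine (ENNReal.add_le_add_iff_left hfin).1 ?_
  have hmeas : AEMeasurable (fun y => ‖f y - m x t‖ₑ) (μ.restrict (box x t)) :=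
    ((hf.sub aestronglyMeasurable_const).enorm).restrict
  calc _ = ENNReal.ofReal (5 * C ^ 2) * μ (box x t) := by
        rw [← add_mul, ← ENNReal.ofReal_add (by positivity) (by positivity)]
        congr 2
        ring
    _ ≤ ∫⁻ _ in box x t, ‖m x t - c‖ₑ ∂μ := by
        rw [setLIntegral_const, enorm_sub_eq]
        gcongr
    _ ≤ ∫⁻ y in box x t, (‖f y - m x t‖ₑ + ‖f y - c‖ₑ) ∂μ := by
        refine lintegral_mono fun y => ?_
        have : m x t - c = -(f y - m x t) + (f y - c) := by ring
        rw [this]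
        refine (enorm_add_le _ _).trans ?_
        rw [enorm_neg]
    _ = ∫⁻ y in box x t, ‖f y - m x t‖ₑ ∂μ + ∫⁻ y in box x t, ‖f y - c‖ₑ ∂μ :=
        lintegral_add_left' hmeas _
    _ ≤ ENNReal.ofReal (C ^ 2) * μ (box x t) + ∫⁻ y in box x t, ‖f y - c‖ₑ ∂μ := by
        gcongr
        calc _ ≤ ENNReal.ofReal C * μ (box x (K * t)) := h.osc x hx t ht
          _ ≤ ENNReal.ofReal C * μ (box x (10 * K * t)) := by
              gcongr
              exact box_mono x (by nlinarith)
          _ ≤ ENNReal.ofReal C * (ENNReal.ofReal C * μ (box x t)) := by gcongr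
          _ = _ := by rw [← mul_assoc, ← ENNReal.ofReal_mul hC0, sq]

/-- The John–Nirenberg inequality for functions of controlled oscillation. -/
lemma OscControl.measure_lt_abs_sub_le (h : OscControl μ f m K C) (hf : AEStronglyMeasurable f μ)
    (hK : 1 ≤ K) (hC : 1 ≤ C) (j : ℕ) {z : Euc d} (hz : InSupp μ z) {l : ℝ} (hl : 0 < l) :
    μ (box z l ∩ {x | j * (5 * C ^ 2 + 5 * C) < |f x - m z l|})
      ≤ (2⁻¹ : ℝ≥0∞) ^ j * μ (box z (2 * K * l)) := by
  induction j generalizing z l with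
  | zero =>
    rw [pow_zero, one_mul]
    exact measure_mono (inter_subset_left.trans (box_mono z (by nlinarith)))
  | succ j ih =>
    have hCsq : 1 ≤ C ^ 2 := one_le_pow₀ hC
    have hCC : C ≤ C ^ 2 := by nlinarith
    set Λ : ℝ := 5 * C ^ 2 + 5 * C with hΛ
    set G : Set (Euc d) := {x | InSupp μ x ∧
      ∀ δ : ℝ, 0 < δ → ∃ s, 0 < s ∧ s < δ ∧ |f x - m x s| ≤ C} with hG_def
    have hG : μ Gᶜ = 0 := (ae_inSupp μ).and h.approx
    set T : Set (Euc d) := G ∩ (box z l ∩ {x | ((j + 1 : ℕ) : ℝ) * Λ < |f x - m z l|}) with hT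
    have hscale : ∀ x, ∃ t, x ∈ T → 0 < t ∧ t ≤ l ∧
        μ (box x (10 * K * t)) ≤ ENNReal.ofReal C * μ (box x t) ∧
        5 * C ^ 2 ≤ |m x t - m z l| ∧ |m x t - m z l| ≤ 5 * C ^ 2 + 3 * C := by
      intro x
      by_cases hxT : x ∈ T
      · obtain ⟨⟨hx, happ⟩, hxz, hfar⟩ := hxT
        rw [Set.mem_ofPred_eq, Nat.cast_add, Nat.cast_one, add_mul, one_mul] at hfar
        have hj : 0 ≤ (j : ℝ) * Λ := by positivity
        obtain ⟨t, h1, h2, h3, h4, h5⟩ := h.exists_stopping_scale (L := 5 * C ^ 2 + C)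
          (by linarith) hz hx hl hxz happ (by linarith)
        exact ⟨t, fun _ => ⟨h1, h2, h3, by linarith, by linarith⟩⟩
      · exact ⟨0, fun hx => absurd hx hxT⟩
    choose t ht using hscale
    obtain ⟨u, huT, hdisj, hcov⟩ := Vitali.exists_disjoint_subfamily_covering_enlargement
      (fun x => box x (t x)) T t 2 one_lt_two (fun x hx => (ht x hx).1.le) l
      (fun x hx => (ht x hx).2.1) (fun x hx => ⟨x, self_mem_box x (ht x hx).1.le⟩)
    have hcount : u.Countable := hdisj.countable_of_nonempty_interior
      fun x hx => interior_box_nonempty x (ht x (huT hx)).1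
    have hsub : box z l ∩ {x | ((j + 1 : ℕ) : ℝ) * Λ < |f x - m z l|} ⊆
        Gᶜ ∪ ⋃ b ∈ u, (box b (5 * t b) ∩ {x | j * Λ < |f x - m b (5 * t b)|}) := by
      intro x hx
      by_cases hxG : x ∈ G
      · right
        have hxT : x ∈ T := ⟨hxG, hx⟩
        obtain ⟨b, hbu, ⟨y, hyx, hyb⟩, hle⟩ := hcov x hxT
        have hb := ht b (huT hbu)
        have hb0 : 0 < t b := hb.1
        refine mem_iUnion₂.2 ⟨b, hbu, fun i => ?_, ?_⟩
        · have h1 : |y i - x i| ≤ t x / 2 := hyx i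
          have h2 : |y i - b i| ≤ t b / 2 := hyb i
          rw [abs_sub_comm] at h1
          have h3 := abs_sub_le (x i) (y i) (b i)
          show |x i - b i| ≤ 5 * t b / 2
          linarith
        · have h1 := h.scale b (huT hbu).1.1 (t b) (5 * t b) hb0 (by linarith) le_rfl
          have h2 : ((j + 1 : ℕ) : ℝ) * Λ < |f x - m z l| := hx.2
          have h3 := abs_sub_le (f x) (m b (5 * t b)) (m z l)
          have h4 := abs_sub_le (m b (5 * t b)) (m b (t b)) (m z l)
          rw [abs_sub_comm] at h1
          rw [Nat.cast_add, Nat.cast_one, add_mul, one_mul] at h2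
          have h5 := hb.2.2.2.2
          show (j : ℝ) * Λ < |f x - m b (5 * t b)|
          linarith
      · exact Or.inl hxG
    have hsum : ENNReal.ofReal (4 * C ^ 2) * ∑' b : u, μ (box (b : Euc d) (t b))
        ≤ 2 * ENNReal.ofReal C * μ (box z (2 * K * l)) := by
      have := hcount.to_subtype
      rw [← ENNReal.tsum_mul_left]
      calc _ ≤ ∑' b : u, ∫⁻ y in box (b : Euc d) (t b), ‖f y - m z l‖ₑ ∂μ := by
            refine ENNReal.tsum_le_tsum fun b => ?_
            have hb := ht b (huT b.2)
            exact h.measure_le_lintegral hf hK hC (huT b.2).1.1 hb.1 hb.2.2.1 hb.2.2.2.1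
        _ = ∫⁻ y in ⋃ b ∈ u, box b (t b), ‖f y - m z l‖ₑ ∂μ :=
            (lintegral_biUnion hcount (fun b _ => measurableSet_box b _) hdisj _).symm
        _ ≤ ∫⁻ y in box z (2 * l), ‖f y - m z l‖ₑ ∂μ := by
            refine lintegral_mono_set (iUnion₂_subset fun b hb => box_subset_box fun i => ?_)
            have h1 : |b i - z i| ≤ l / 2 := (huT hb).2.1 i
            have h2 := (ht b (huT hb)).2.1
            linarith
        _ ≤ _ := h.lintegral_double_le hK hz hl
    have hC0 : ENNReal.ofReal C ≠ 0 := by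
      rw [Ne, ENNReal.ofReal_eq_zero]
      linarith
    have hhalf : ENNReal.ofReal C * ∑' b : u, μ (box (b : Euc d) (t b))
        ≤ 2⁻¹ * μ (box z (2 * K * l)) := by
      have h4 : ENNReal.ofReal (4 * C ^ 2) = 2 * ENNReal.ofReal C * (2 * ENNReal.ofReal C) := by
        rw [show (4 : ℝ) * C ^ 2 = 2 * C * (2 * C) by ring, ENNReal.ofReal_mul (by positivity),
          ENNReal.ofReal_mul zero_le_two, ENNReal.ofReal_ofNat]
      rw [h4, mul_assoc, ENNReal.mul_le_mul_iff_right (by simp [hC0])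
        (ENNReal.mul_ne_top ENNReal.ofNat_ne_top ENNReal.ofReal_ne_top), mul_assoc] at hsum
      rw [← ENNReal.div_eq_inv_mul]
      rw [ENNReal.le_div_iff_mul_le (Or.inl two_ne_zero) (Or.inl ENNReal.ofNat_ne_top), mul_comm]
      exact hsum
    calc _ ≤ μ Gᶜ + μ (⋃ b ∈ u, (box b (5 * t b) ∩ {x | j * Λ < |f x - m b (5 * t b)|})) :=
          (measure_mono hsub).trans (measure_union_le _ _)
      _ ≤ ∑' b : u, μ (box (b : Euc d) (5 * t b) ∩ {x | j * Λ < |f x - m b (5 * t b)|}) := by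
          rw [hG, zero_add]
          exact measure_biUnion_le μ hcount _
      _ ≤ ∑' b : u, (2⁻¹ : ℝ≥0∞) ^ j * (ENNReal.ofReal C * μ (box (b : Euc d) (t b))) := by
          refine ENNReal.tsum_le_tsum fun b => ?_
          have hb := ht b (huT b.2)
          have hb0 : 0 < t b := hb.1
          refine (ih (huT b.2).1.1 (l := 5 * t b) (by positivity)).trans ?_
          rw [show 2 * K * (5 * t b) = 10 * K * t b by ring]
          gcongr
          exact hb.2.2.1
      _ = (2⁻¹ : ℝ≥0∞) ^ j * (ENNReal.ofReal C * ∑' b : u, μ (box (b : Euc d) (t b))) := by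
          rw [ENNReal.tsum_mul_left, ENNReal.tsum_mul_left]
      _ ≤ (2⁻¹ : ℝ≥0∞) ^ j * (2⁻¹ * μ (box z (2 * K * l))) := by gcongr
      _ = _ := by rw [pow_succ, mul_assoc ((2⁻¹ : ℝ≥0∞) ^ j)]

end JohnNirenberg

section ExponentialIntegrability

variable {d : ℕ} {μ : Measure (Euc d)} [IsLocallyFiniteMeasure μ] {f : Euc d → ℝ}
  {m : Euc d → ℝ → ℝ} {K C : ℝ}

lemma exp_div_le_tsum {Λ a v : ℝ} (hΛ : 0 < Λ) (ha : 0 < a) (hexp : Real.exp (Λ / a) ≤ 3 / 2)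
    (hv : 0 ≤ v) :
    ENNReal.ofReal (Real.exp (v / a))
      ≤ 1 + ∑' i : ℕ, if i * Λ < v then ENNReal.ofReal ((3 / 2) ^ (i + 1)) else 0 := by
  rcases hv.eq_or_lt with rfl | hv
  · simp
  obtain ⟨k, hk⟩ : ∃ k, ⌈v / Λ⌉₊ = k + 1 :=
    Nat.exists_eq_succ_of_ne_zero (Nat.ceil_pos.2 (div_pos hv hΛ)).ne'
  have h1 : v ≤ (k + 1 : ℕ) * Λ := by
    rw [← div_le_iff₀ hΛ, ← hk]
    exact Nat.le_ceil _
  have h2 : k * Λ < v := by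
    rw [← lt_div_iff₀ hΛ]
    exact Nat.lt_ceil.1 (by omega)
  have h3 : Real.exp (v / a) ≤ (3 / 2) ^ (k + 1) := by
    calc Real.exp (v / a) ≤ Real.exp ((k + 1 : ℕ) * (Λ / a)) := by
          rw [← mul_div_assoc]
          gcongr
      _ = Real.exp (Λ / a) ^ (k + 1) := Real.exp_nat_mul _ _
      _ ≤ _ := by gcongr
  calc _ ≤ ENNReal.ofReal ((3 / 2) ^ (k + 1)) := ENNReal.ofReal_le_ofReal h3
    _ = if k * Λ < v then ENNReal.ofReal ((3 / 2) ^ (k + 1)) else 0 := (if_pos h2).symm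
    _ ≤ ∑' i : ℕ, if i * Λ < v then ENNReal.ofReal ((3 / 2) ^ (i + 1)) else 0 :=
        ENNReal.le_tsum k
    _ ≤ _ := le_add_self

/-- Local exponential integrability of functions of controlled oscillation. -/
lemma OscControl.lintegral_exp_le (h : OscControl μ f m K C) (hf : AEStronglyMeasurable f μ)
    (hK : 1 ≤ K) (hC : 1 ≤ C) {a : ℝ} (ha : 0 < a)
    (hexp : Real.exp ((5 * C ^ 2 + 5 * C) / a) ≤ 3 / 2) {z : Euc d} (hz : InSupp μ z) {l : ℝ}
    (hl : 0 < l) :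
    ∫⁻ x in box z l, ENNReal.ofReal (Real.exp (|f x - m z l| / a)) ∂μ
      ≤ 7 * μ (box z (2 * K * l)) := by
  set Λ : ℝ := 5 * C ^ 2 + 5 * C with hΛ_def
  have hΛ : 0 < Λ := by positivity
  have hnull : ∀ i : ℕ, NullMeasurableSet {x | i * Λ < |f x - m z l|} (μ.restrict (box z l)) :=
    fun i => nullMeasurableSet_lt aemeasurable_const
      ((hf.restrict.sub aestronglyMeasurable_const).norm.aemeasurable)
  have hterm : ∀ i : ℕ, (fun x => if i * Λ < |f x - m z l| then
      ENNReal.ofReal ((3 / 2) ^ (i + 1)) else 0) =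
      {x | i * Λ < |f x - m z l|}.indicator fun _ => ENNReal.ofReal ((3 / 2) ^ (i + 1)) :=
    fun i => rfl
  have hfint : ∀ i : ℕ, ∫⁻ x in box z l, (if i * Λ < |f x - m z l| then
      ENNReal.ofReal ((3 / 2) ^ (i + 1)) else 0) ∂μ
      ≤ ENNReal.ofReal (3 / 2 * (3 / 4) ^ i) * μ (box z (2 * K * l)) := by
    intro i
    rw [hterm, lintegral_indicator_const₀ (hnull i), Measure.restrict_apply₀ (hnull i),
      Set.inter_comm]
    refine (mul_le_mul_right (h.measure_lt_abs_sub_le hf hK hC i hz hl) _).trans_eq ?_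
    have h2 : (2⁻¹ : ℝ≥0∞) = ENNReal.ofReal 2⁻¹ := by
      rw [ENNReal.ofReal_inv_of_pos zero_lt_two, ENNReal.ofReal_ofNat]
    rw [h2, ← ENNReal.ofReal_pow (by norm_num), ← mul_assoc, ← ENNReal.ofReal_mul (by positivity)]
    congr 2
    rw [pow_succ, mul_right_comm, ← mul_pow]
    norm_num
    ring
  have hgeom : ∑' i : ℕ, ENNReal.ofReal (3 / 2 * (3 / 4) ^ i) = 6 := by
    rw [← ENNReal.ofReal_tsum_of_nonneg (fun i => by positivity)
      ((summable_geometric_of_lt_one (by norm_num) (by norm_num)).mul_left _), tsum_mul_left,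
      tsum_geometric_of_lt_one (by norm_num) (by norm_num)]
    norm_num
  calc _ ≤ ∫⁻ x in box z l, (1 + ∑' i : ℕ, if i * Λ < |f x - m z l| then
        ENNReal.ofReal ((3 / 2) ^ (i + 1)) else 0) ∂μ :=
        lintegral_mono fun x => exp_div_le_tsum hΛ ha hexp (abs_nonneg _)
    _ = μ (box z l) + ∑' i : ℕ, ∫⁻ x in box z l, (if i * Λ < |f x - m z l| then
        ENNReal.ofReal ((3 / 2) ^ (i + 1)) else 0) ∂μ := by
        rw [lintegral_add_left measurable_const, setLIntegral_one, lintegral_tsum]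
        intro i
        rw [hterm]
        exact aemeasurable_const.indicator₀ (hnull i)
    _ ≤ μ (box z (2 * K * l)) + ∑' i : ℕ, ENNReal.ofReal (3 / 2 * (3 / 4) ^ i)
          * μ (box z (2 * K * l)) := by
        gcongr with i
        · exact box_mono z (by nlinarith)
        · exact hfint i
    _ = _ := by
        rw [ENNReal.tsum_mul_right, hgeom]
        nth_rw 1 [← one_mul (μ (box z (2 * K * l)))]
        rw [← add_mul]
        norm_num

/-- A polynomially decaying weight is dominated by a sum over dyadic boxes. -/
lemma weight_le_tsum (n : ℕ) {κ : ℝ} (hκ : 0 ≤ κ) (x : Euc d) :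
    ENNReal.ofReal (((1 + ‖x‖) ^ (2 * (n : ℝ) + κ))⁻¹)
      ≤ ∑' j : ℕ, (box (0 : Euc d) (2 ^ j)).indicator
          (fun _ => ENNReal.ofReal (16 ^ n * ((4 ^ n) ^ j)⁻¹)) x := by
  have hmem : ∃ j : ℕ, x ∈ box (0 : Euc d) (2 ^ j) := by
    obtain ⟨j, hj⟩ := pow_unbounded_of_one_lt (2 * ‖x‖) one_lt_two
    refine ⟨j, closedBall_subset_box _ _ ?_⟩
    rw [mem_closedBall, dist_zero_right]
    linarith
  have hx : 0 ≤ ‖x‖ := norm_nonneg x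
  have hpow : (1 + ‖x‖) ^ (2 * n) ≤ (1 + ‖x‖) ^ (2 * (n : ℝ) + κ) := by
    rw [← Real.rpow_natCast, Nat.cast_mul, Nat.cast_ofNat]
    exact Real.rpow_le_rpow_of_exponent_le (by linarith) (by linarith)
  classical
  have hspec := Nat.find_spec hmem
  refine le_trans ?_ (ENNReal.le_tsum (Nat.find hmem))
  rw [indicator_of_mem hspec]
  refine ENNReal.ofReal_le_ofReal ?_
  have hpos : (0 : ℝ) < (1 + ‖x‖) ^ (2 * n) := by positivity
  refine (inv_anti₀ hpos hpow).trans ?_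
  rcases hj : Nat.find hmem with _ | j
  · rw [pow_zero, inv_one, mul_one]
    exact (inv_le_one_of_one_le₀ (one_le_pow₀ (by linarith))).trans (one_le_pow₀ (by norm_num))
  · have hnot : x ∉ box (0 : Euc d) (2 ^ j) := Nat.find_min hmem (by omega)
    rw [mem_box] at hnot
    push Not at hnot
    obtain ⟨i, hi⟩ := hnot
    have h1 : 2 ^ j / 2 < ‖x‖ := by
      refine hi.trans_le ?_
      have := PiLp.norm_apply_le x i
      simpa using this
    have h2 : ((2 : ℝ) ^ j / 2) ^ (2 * n) ≤ (1 + ‖x‖) ^ (2 * n) := by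
      gcongr
      linarith
    refine (inv_anti₀ (by positivity) h2).trans_eq ?_
    have h3 : ((2 : ℝ) ^ j / 2) ^ 2 = 4 ^ (j + 1) / 16 := by
      rw [div_pow, ← pow_mul, mul_comm, pow_mul, pow_succ]
      norm_num
      ring
    rw [pow_mul, h3, div_pow, inv_div, ← pow_mul, ← pow_mul, mul_comm (j + 1), div_eq_mul_inv]

/-- Weighted global exponential integrability of functions of controlled oscillation. -/
lemma OscControl.lintegral_exp_mul_weight_le (h : OscControl μ f m K C)
    (hf : AEStronglyMeasurable f μ) (hK : 1 ≤ K) (hC : 1 ≤ C) {a : ℝ} (ha : 0 < a)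
    (hexp : Real.exp ((5 * C ^ 2 + 5 * C) / a) ≤ 3 / 2) (h0 : InSupp μ (0 : Euc d)) {n : ℕ}
    (hn : 0 < n) {κ C₀ : ℝ} (hκ : 0 ≤ κ) (hC₀ : 0 ≤ C₀)
    (hg : ∀ s, 0 < s → μ (box (0 : Euc d) s) ≤ ENNReal.ofReal (C₀ * s ^ n)) {q : ℝ}
    (hq : |q - m 0 1| ≤ C) :
    ∫⁻ x, ENNReal.ofReal (Real.exp (|f x - q| / a) * ((1 + ‖x‖) ^ (2 * (n : ℝ) + κ))⁻¹) ∂μ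
      ≤ ENNReal.ofReal (42 * 16 ^ n * C₀ * (2 * K) ^ n) := by
  have hK0 : 0 < K := by linarith
  have hdist : ∀ j : ℕ, |m 0 (2 ^ j) - q| ≤ (j + 1 : ℕ) * C := by
    intro j
    induction j with
    | zero =>
      rw [abs_sub_comm] at hq
      simpa using hq
    | succ j ih =>
      have h1 := h.scale 0 h0 (2 ^ j) (2 ^ (j + 1)) (by positivity) (by rw [pow_succ]; simp)
        (by rw [pow_succ, mul_comm]; gcongr; norm_num)
      have h2 := abs_sub_le (m 0 (2 ^ (j + 1))) (m 0 (2 ^ j)) q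
      rw [abs_sub_comm] at h1
      push_cast at ih ⊢
      linarith
  have hexpC : Real.exp (C / a) ≤ 3 / 2 := by
    refine le_trans ?_ hexp
    gcongr
    nlinarith [sq_nonneg C]
  have hbox : ∀ j : ℕ, ∫⁻ x in box (0 : Euc d) (2 ^ j),
      ENNReal.ofReal (Real.exp (|f x - q| / a)) ∂μ
      ≤ ENNReal.ofReal ((3 / 2) ^ (j + 1) * (7 * (C₀ * (2 * K * 2 ^ j) ^ n))) := by
    intro j
    calc _ ≤ ∫⁻ x in box (0 : Euc d) (2 ^ j), ENNReal.ofReal ((3 / 2) ^ (j + 1)) *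
          ENNReal.ofReal (Real.exp (|f x - m 0 (2 ^ j)| / a)) ∂μ := by
          refine lintegral_mono fun x => ?_
          rw [← ENNReal.ofReal_mul (by positivity)]
          refine ENNReal.ofReal_le_ofReal ?_
          calc Real.exp (|f x - q| / a)
              ≤ Real.exp ((j + 1 : ℕ) * (C / a) + |f x - m 0 (2 ^ j)| / a) := by
                rw [← mul_div_assoc, ← add_div]
                gcongr
                have := abs_sub_le (f x) (m 0 (2 ^ j)) q
                linarith [hdist j]
            _ = Real.exp (C / a) ^ (j + 1) * Real.exp (|f x - m 0 (2 ^ j)| / a) := by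
                rw [Real.exp_add, Real.exp_nat_mul]
            _ ≤ _ := by gcongr
      _ = ENNReal.ofReal ((3 / 2) ^ (j + 1)) *
          ∫⁻ x in box (0 : Euc d) (2 ^ j), ENNReal.ofReal (Real.exp (|f x - m 0 (2 ^ j)| / a)) ∂μ :=
          lintegral_const_mul' _ _ ENNReal.ofReal_ne_top
      _ ≤ ENNReal.ofReal ((3 / 2) ^ (j + 1)) *
          (7 * ENNReal.ofReal (C₀ * (2 * K * 2 ^ j) ^ n)) := by
          gcongr
          refine (h.lintegral_exp_le hf hK hC ha hexp h0 (by positivity)).trans ?_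
          gcongr
          exact hg _ (by positivity)
      _ = _ := by
          rw [ENNReal.ofReal_mul (p := (3 / 2) ^ (j + 1)) (by positivity),
            ENNReal.ofReal_mul (p := 7) (by norm_num),
            ENNReal.ofReal_ofNat]
  have hmeas : AEMeasurable (fun x => ENNReal.ofReal (Real.exp (|f x - q| / a))) μ := by
    have := (hf.sub (aestronglyMeasurable_const (b := q))).norm.aemeasurable
    exact ((this.div_const a).exp).ennreal_ofReal
  have hsum : ∀ j : ℕ, 16 ^ n * ((4 ^ n) ^ j)⁻¹ *
      ((3 / 2) ^ (j + 1) * (7 * (C₀ * (2 * K * 2 ^ j) ^ n)))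
      ≤ 16 ^ n * 7 * C₀ * (2 * K) ^ n * (3 / 2) * (3 / 4) ^ j := by
    intro j
    have h1 : ((4 : ℝ) ^ n) ^ j = (2 ^ j) ^ n * (2 ^ n) ^ j := by
      rw [← pow_mul, ← pow_mul, ← pow_mul, mul_comm j n, ← mul_pow]
      norm_num
    have h2 : ((2 : ℝ) ^ n)⁻¹ ≤ 1 / 2 := by
      rw [← one_div]
      gcongr
      exact le_self_pow₀ one_le_two hn.ne'
    calc _ = 16 ^ n * 7 * C₀ * (2 * K) ^ n * (3 / 2) * ((3 / 2) * (2 ^ n)⁻¹) ^ j := by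
          rw [h1, mul_pow (2 * K), mul_pow (3 / 2 : ℝ), inv_pow, pow_succ]
          field_simp
      _ ≤ 16 ^ n * 7 * C₀ * (2 * K) ^ n * (3 / 2) * ((3 / 2) * (1 / 2)) ^ j := by gcongr
      _ = _ := by norm_num
  calc _ ≤ ∫⁻ x, ∑' j : ℕ, (box (0 : Euc d) (2 ^ j)).indicator (fun x =>
        ENNReal.ofReal (16 ^ n * ((4 ^ n) ^ j)⁻¹) *
          ENNReal.ofReal (Real.exp (|f x - q| / a))) x ∂μ := by
        refine lintegral_mono fun x => ?_
        rw [ENNReal.ofReal_mul (Real.exp_pos _).le]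
        refine (mul_le_mul_right (weight_le_tsum n hκ x) _).trans_eq ?_
        rw [← ENNReal.tsum_mul_left]
        refine tsum_congr fun j => ?_
        by_cases hx : x ∈ box (0 : Euc d) (2 ^ j)
        · rw [indicator_of_mem hx, indicator_of_mem hx, mul_comm]
        · rw [indicator_of_notMem hx, indicator_of_notMem hx, mul_zero]
    _ = ∑' j : ℕ, ENNReal.ofReal (16 ^ n * ((4 ^ n) ^ j)⁻¹) *
        ∫⁻ x in box (0 : Euc d) (2 ^ j), ENNReal.ofReal (Real.exp (|f x - q| / a)) ∂μ := by
        rw [lintegral_tsum fun j => (hmeas.const_mul _).indicator (measurableSet_box _ _)]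
        refine tsum_congr fun j => ?_
        rw [lintegral_indicator (measurableSet_box _ _),
          lintegral_const_mul' _ _ ENNReal.ofReal_ne_top]
    _ ≤ ∑' j : ℕ, ENNReal.ofReal (16 ^ n * 7 * C₀ * (2 * K) ^ n * (3 / 2) * (3 / 4) ^ j) := by
        refine ENNReal.tsum_le_tsum fun j => ?_
        refine (mul_le_mul_right (hbox j) _).trans ?_
        rw [← ENNReal.ofReal_mul (by positivity)]
        exact ENNReal.ofReal_le_ofReal (hsum j)
    _ = _ := by
        rw [← ENNReal.ofReal_tsum_of_nonneg (fun i => by positivity)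
          ((summable_geometric_of_lt_one (by norm_num) (by norm_num)).mul_left _), tsum_mul_left,
          tsum_geometric_of_lt_one (by norm_num) (by norm_num)]
        congr 1
        norm_num
        ring

lemma exp_div_sub_one_le (u : ℝ) {N : ℕ} (hN : 0 < N) :
    Real.exp (u / N) - 1 ≤ (N : ℝ)⁻¹ * Real.exp u := by
  have hN' : (0 : ℝ) < N := by exact_mod_cast hN
  have h1 := one_add_mul_le_pow (a := Real.exp (u / N) - 1)
    (by linarith [Real.exp_pos (u / N)]) N
  rw [add_sub_cancel, ← Real.exp_nat_mul, mul_div_cancel₀ u hN'.ne'] at h1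
  rw [← div_eq_inv_mul, le_div_iff₀ hN', mul_comm]
  linarith

lemma cubeAvg_const_mul (μ : Measure (Euc d)) (Q : Cube d) (c : ℝ) (f : Euc d → ℝ) :
    cubeAvg μ Q (fun x => c * f x) = c * cubeAvg μ Q f := by
  simp only [cubeAvg]
  rw [integral_const_mul]
  ring

lemma RBMOBound.inv_mul {μ : Measure (Euc d)} {n : ℕ} {η ρ β D : ℝ} (hD : 0 < D)
    (h : RBMOBound μ n η ρ β f D) : RBMOBound μ n η ρ β (fun x => D⁻¹ * f x) 1 := by
  have habs : ∀ u v : ℝ, |D⁻¹ * u - D⁻¹ * v| = D⁻¹ * |u - v| := fun u v => by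
    rw [← mul_sub, abs_mul, abs_of_pos (inv_pos.2 hD)]
  refine ⟨fun Q hQ => ?_, fun Q R hQ hR hQR hdQ hdR => ?_⟩
  · simp only [cubeAvg_const_mul, habs]
    rw [integral_const_mul, one_mul, inv_mul_le_iff₀ hD]
    exact h.1 Q hQ
  · simp only [cubeAvg_const_mul, habs]
    rw [one_mul, inv_mul_le_iff₀ hD]
    exact h.2 Q R hQ hR hQR hdQ hdR

end ExponentialIntegrability

/-- weighted exponential integrability of `f − f_{𝕢̃}` over all of `ℝ^d`,
where `𝕢` is the unit cube centered at the origin. -/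
theorem exp_integral_weighted_RBMO
    {d n : ℕ} (μ : Measure (Euc d)) (C₀ η ρ β κ : ℝ)
    (hn : 0 < n) (hnd : n ≤ d) (hC₀ : 0 < C₀)
    (hgrowth : ∀ x : Euc d, ∀ r : ℝ, 0 < r →
      μ (Metric.ball x r) ≤ ENNReal.ofReal (C₀ * r ^ n))
    (hgrowthQ : ∀ Q : Cube d, IsCube μ Q → μ Q.set ≤ ENNReal.ofReal (C₀ * Q.side ^ n))
    (hη : 1 < η) (hρ : 1 < ρ) (hβ : ρ ^ n < β) (hκ : 0 < κ)
    (h0 : ∀ r : ℝ, 0 < r → 0 < μ (Metric.ball (0 : Euc d) r)) :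
    ∃ C₇ : ℝ, 0 < C₇ ∧
      ∀ f : Euc d → ℝ, MemRBMO μ n η ρ β f → 0 < rbmoNorm μ n η ρ β f →
        ∫⁻ x : Euc d,
            ENNReal.ofReal
              ((Real.exp (|f x - cubeAvg μ (tilde μ ρ β (Cube.mk (0 : Euc d) 1)) f|
                  / (C₇ * rbmoNorm μ n η ρ β f)) - 1)
                * ((1 + ‖x‖) ^ (2 * (n : ℝ) + κ))⁻¹) ∂μ
          ≤ 1 := by
  have hloc : IsLocallyFiniteMeasure μ := isLocallyFiniteMeasure_of_growth hgrowth
  have hgBox : ∀ x, InSupp μ x → ∀ s, 0 < s → μ (box x s) ≤ ENNReal.ofReal (C₀ * s ^ n) :=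
    fun x hx s hs => hgrowthQ (Cube.mk x s) ⟨hs, hx⟩
  have hg : ∀ x, InSupp μ x → ∀ s, 0 < s → mass μ x s ≤ C₀ * s ^ n :=
    fun x hx s hs => ENNReal.toReal_le_of_le_ofReal (by positivity) (hgBox x hx s hs)
  obtain ⟨K, C, hK, hC, hctrl⟩ := exists_oscControl (hn.trans_le hnd) hC₀ hη hρ hβ hg h0
  have hlog : 0 < Real.log (3 / 2) := Real.log_pos (by norm_num)
  set a : ℝ := (5 * C ^ 2 + 5 * C) / Real.log (3 / 2) with ha_def
  have ha : 0 < a := by positivity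
  have hexp : Real.exp ((5 * C ^ 2 + 5 * C) / a) ≤ 3 / 2 := by
    rw [ha_def, div_div_cancel₀ (by positivity), Real.exp_log (by norm_num)]
  obtain ⟨N, hN⟩ := exists_nat_gt (42 * 16 ^ n * C₀ * (2 * K) ^ n)
  have hN0 : (0 : ℝ) < N := lt_of_le_of_lt (by positivity) hN
  refine ⟨2 * a * N, by positivity, fun f hf hnorm => ?_⟩
  obtain ⟨hfloc, D₀, hD₀⟩ := hf
  have hbdd : BddBelow {D : ℝ | 0 ≤ D ∧ RBMOBound μ n η ρ β f D} := ⟨0, fun D hD => hD.1⟩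
  obtain ⟨D, hDmem, hD2⟩ := exists_lt_of_csInf_lt ⟨D₀, hD₀⟩
    (show sInf {D : ℝ | 0 ≤ D ∧ RBMOBound μ n η ρ β f D} < 2 * rbmoNorm μ n η ρ β f by
      change rbmoNorm μ n η ρ β f < _
      linarith)
  have hD : 0 < D := hnorm.trans_le (csInf_le hbdd hDmem)
  have hfloc' : LocallyIntegrable (fun x => D⁻¹ * f x) μ := hfloc.smul D⁻¹
  obtain ⟨m, hm, hq⟩ := hctrl _ hfloc' (hDmem.2.inv_mul hD)
  have hmain := hm.lintegral_exp_mul_weight_le hfloc'.aestronglyMeasurable hK hC ha hexp h0 hn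
    hκ.le hC₀.le (hgBox 0 h0) hq
  simp only [cubeAvg_const_mul] at hmain
  set q := cubeAvg μ (tilde μ ρ β (Cube.mk (0 : Euc d) 1)) f
  calc _ ≤ ∫⁻ x : Euc d, ENNReal.ofReal (N : ℝ)⁻¹ * ENNReal.ofReal
        (Real.exp (|D⁻¹ * f x - D⁻¹ * q| / a) * ((1 + ‖x‖) ^ (2 * (n : ℝ) + κ))⁻¹) ∂μ := by
        refine lintegral_mono fun x => ?_
        rw [← ENNReal.ofReal_mul (by positivity), ← mul_assoc]
        refine ENNReal.ofReal_le_ofReal ?_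
        gcongr
        refine le_trans ?_ (exp_div_sub_one_le _ (by exact_mod_cast hN0))
        have h1 : |f x - q| / (2 * a * N * rbmoNorm μ n η ρ β f)
            ≤ |D⁻¹ * f x - D⁻¹ * q| / a / N := by
          rw [← mul_sub, abs_mul, abs_of_pos (inv_pos.2 hD), div_div, ← div_eq_inv_mul, div_div]
          refine div_le_div_of_nonneg_left (abs_nonneg _) (by positivity) ?_
          nlinarith [mul_pos ha hN0]
        gcongr
    _ = ENNReal.ofReal (N : ℝ)⁻¹ * ∫⁻ x : Euc d, ENNReal.ofReal
        (Real.exp (|D⁻¹ * f x - D⁻¹ * q| / a) * ((1 + ‖x‖) ^ (2 * (n : ℝ) + κ))⁻¹) ∂μ :=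
        lintegral_const_mul' _ _ ENNReal.ofReal_ne_top
    _ ≤ ENNReal.ofReal (N : ℝ)⁻¹ * ENNReal.ofReal (42 * 16 ^ n * C₀ * (2 * K) ^ n) := by
        gcongr
    _ ≤ 1 := by
        rw [← ENNReal.ofReal_mul (by positivity), ← ENNReal.ofReal_one]
        refine ENNReal.ofReal_le_ofReal ?_
        rw [← div_eq_inv_mul, div_le_one hN0]
        exact hN.le
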